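/- arXiv:1302.1797 — 2 statements merged into one kernel-verified Lean document; each statement's English description precedes it below -/
import Mathlib

section
/- Let f and g be complete Bernstein functions and let 0 ≤ α ≤ 1. Then the pointwise product h(p) := f(p)^α · g(p)^{1−α} (with the convention 0^0 = 1 and 0^β = 0 for β > 0) is a complete Bernstein function. -/
open MeasureTheory Set Filter

/-- A Bernstein function: nonnegative, continuous on `[0,∞)`, smooth on `(0,∞)`,
with `(-1)^{n-1} f⁽ⁿ⁾(x) ≥ 0` for all `x > 0` and all integers `n ≥ 1`. -/
def IsBernstein (f : ℝ → ℝ) : Prop :=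
  (∀ x : ℝ, 0 ≤ x → 0 ≤ f x) ∧ ContinuousOn f (Set.Ici 0) ∧
  ContDiffOn ℝ (⊤ : ℕ∞) f (Set.Ioi 0) ∧
  ∀ n : ℕ, 1 ≤ n → ∀ x : ℝ, 0 < x →
    0 ≤ (-1 : ℝ) ^ (n - 1) * iteratedDerivWithin n f (Set.Ioi 0) x

/-- A complete Bernstein function: `f(x) = x² ∫₀^∞ e^{-xt} g(t) dt` for some Bernstein
function `g`. -/
def IsCBF (f : ℝ → ℝ) : Prop :=
  ∃ g : ℝ → ℝ, IsBernstein g ∧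
    ∀ x : ℝ, 0 < x → f x = x ^ 2 * ∫ t in Set.Ioi (0 : ℝ), Real.exp (-x * t) * g t

/-! ### Mixtures of weighted harmonic means -/

/-- The weighted harmonic mean of `x` (with weight `1 - u`) and `1` (with weight `u`). -/
noncomputable def harmonicKernel (x : ℝ) (u : unitInterval) : ℝ := x / (1 + (x - 1) * u)

/-- `f` is, on `(0, ∞)`, a mixture of weighted harmonic means of `x` and `1`. -/
def IsHarmonicMixture (f : ℝ → ℝ) : Prop :=
  ∃ ν : FiniteMeasure unitInterval, ∀ x : ℝ, 0 < x →
    f x = ∫ u, harmonicKernel x u ∂(ν : Measure unitInterval)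

lemma harmonicKernel_denom_pos {x : ℝ} (hx : 0 < x) (u : unitInterval) :
    0 < 1 + (x - 1) * (u : ℝ) := by
  have h0 := u.2.1
  have h1 := u.2.2
  rcases h1.lt_or_eq with h | h
  · nlinarith [mul_nonneg hx.le h0]
  · rw [h]; linarith

lemma harmonicKernel_pos {x : ℝ} (hx : 0 < x) (u : unitInterval) : 0 < harmonicKernel x u :=
  div_pos hx (harmonicKernel_denom_pos hx u)

lemma continuous_harmonicKernel {x : ℝ} (hx : 0 < x) : Continuous (harmonicKernel x) := by
  unfold harmonicKernel
  exact continuous_const.div (by fun_prop) fun u => (harmonicKernel_denom_pos hx u).ne'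

/-- The kernel as a bounded continuous function. -/
noncomputable def harmonicKernelBCF {x : ℝ} (hx : 0 < x) :
    BoundedContinuousFunction unitInterval ℝ :=
  BoundedContinuousFunction.mkOfCompact ⟨harmonicKernel x, continuous_harmonicKernel hx⟩

lemma integrable_harmonicKernel {x : ℝ} (hx : 0 < x) (ν : Measure unitInterval)
    [IsFiniteMeasure ν] : Integrable (harmonicKernel x) ν :=
  (harmonicKernelBCF hx).integrable ν

@[simp] lemma harmonicKernel_one (u : unitInterval) : harmonicKernel 1 u = 1 := by
  simp [harmonicKernel]

namespace IsHarmonicMixture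

lemma congr {f g : ℝ → ℝ} (hf : IsHarmonicMixture f) (h : ∀ x, 0 < x → g x = f x) :
    IsHarmonicMixture g := by
  obtain ⟨ν, hν⟩ := hf
  exact ⟨ν, fun x hx => (h x hx).trans (hν x hx)⟩

lemma zero : IsHarmonicMixture fun _ => 0 := ⟨0, fun x _ => by simp⟩

lemma add {f g : ℝ → ℝ} (hf : IsHarmonicMixture f) (hg : IsHarmonicMixture g) :
    IsHarmonicMixture fun x => f x + g x := by
  obtain ⟨μ, hμ⟩ := hf
  obtain ⟨ν, hν⟩ := hg
  refine ⟨μ + ν, fun x hx => ?_⟩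
  simp only [FiniteMeasure.toMeasure_add]
  rw [integral_add_measure (integrable_harmonicKernel hx _) (integrable_harmonicKernel hx _),
    hμ x hx, hν x hx]

lemma const_mul {f : ℝ → ℝ} (hf : IsHarmonicMixture f) {c : ℝ} (hc : 0 ≤ c) :
    IsHarmonicMixture fun x => c * f x := by
  obtain ⟨μ, hμ⟩ := hf
  refine ⟨c.toNNReal • μ, fun x hx => ?_⟩
  rw [FiniteMeasure.toMeasure_smul, integral_smul_nnreal_measure, ← hμ x hx, NNReal.smul_def,
    Real.coe_toNNReal c hc, smul_eq_mul]

lemma kernel (u : unitInterval) : IsHarmonicMixture fun x => harmonicKernel x u :=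
  ⟨⟨Measure.dirac u, inferInstance⟩, fun x _ => by simp⟩

lemma sum {ι : Type*} (s : Finset ι) {f : ι → ℝ → ℝ} (hf : ∀ i ∈ s, IsHarmonicMixture (f i)) :
    IsHarmonicMixture fun x => ∑ i ∈ s, f i x := by
  classical
  induction s using Finset.induction_on with
  | empty => simpa using zero
  | insert a s ha ih =>
    simp only [Finset.sum_insert ha]
    exact (hf a (by simp)).add (ih fun i hi => hf i (by simp [hi]))

lemma of_tendsto {F : ℕ → ℝ → ℝ} {f : ℝ → ℝ} (hF : ∀ n, IsHarmonicMixture (F n))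
    (h : ∀ x, 0 < x → Tendsto (fun n => F n x) atTop (nhds (f x))) : IsHarmonicMixture f := by
  choose ν hν using hF
  have hmass (n : ℕ) : ((ν n).mass : ℝ) = F n 1 := by
    rw [hν n 1 one_pos]
    simp only [harmonicKernel_one, integral_const, smul_eq_mul, mul_one]
    rfl
  obtain ⟨C, hC⟩ := (h 1 one_pos).bddAbove_range
  have hK := isCompact_setOfPred_finiteMeasure_le_of_compactSpace unitInterval C.toNNReal
  let U : Ultrafilter ℕ := Ultrafilter.of atTop
  have hU : (U : Filter ℕ) ≤ atTop := Ultrafilter.of_le atTop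
  obtain ⟨μ, -, hμ⟩ := hK.ultrafilter_le_nhds (U.map ν) (by
    rw [Filter.le_principal_iff]
    refine Filter.mem_map.2 (Filter.univ_mem' fun n => ?_)
    refine NNReal.le_toNNReal_of_coe_le ?_
    rw [hmass]
    exact hC ⟨n, rfl⟩)
  have hlim : Tendsto ν U (nhds μ) := hμ
  refine ⟨μ, fun x hx => ?_⟩
  refine tendsto_nhds_unique ((h x hx).mono_left hU) ?_
  simp only [hν _ x hx]
  exact FiniteMeasure.tendsto_iff_forall_integral_tendsto.1 hlim (harmonicKernelBCF hx)

lemma eq_zero_or_pos {f : ℝ → ℝ} (hf : IsHarmonicMixture f) :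
    (∀ x, 0 < x → f x = 0) ∨ ∀ x, 0 < x → 0 < f x := by
  obtain ⟨ν, hν⟩ := hf
  by_cases h : (ν : Measure unitInterval) = 0
  · left; intro x hx; rw [hν x hx, h]; simp
  · right
    intro x hx
    rw [hν x hx, integral_pos_iff_support_of_nonneg (fun u => (harmonicKernel_pos hx u).le)
      (integrable_harmonicKernel hx _)]
    have : Function.support (harmonicKernel x) = univ :=
      Set.eq_univ_of_forall fun u => (harmonicKernel_pos hx u).ne'
    rw [this]
    exact Measure.measure_univ_pos.2 h

end IsHarmonicMixture

/-! ### Parallel sums -/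

open scoped RealInnerProductSpace

/-- Spectral decomposition of the resolvent of a symmetric operator between `0` and `1`. -/
lemma isHarmonicMixture_resolvent {E : Type*} [NormedAddCommGroup E] [InnerProductSpace ℝ E]
    [FiniteDimensional ℝ E] {T : E →ₗ[ℝ] E} (hT : T.IsSymmetric)
    (hT0 : ∀ z, 0 ≤ ⟪T z, z⟫) (hT1 : ∀ z, ⟪T z, z⟫ ≤ ⟪z, z⟫) (p : E) (r : ℝ → E)
    (hr : ∀ x, 0 < x → r x + (x - 1) • T (r x) = p) :
    IsHarmonicMixture fun x => x * ⟪p, r x⟫ := by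
  let b := hT.eigenvectorBasis rfl
  let l := hT.eigenvalues rfl
  have hTb (i) : T (b i) = l i • b i := hT.apply_eigenvectorBasis rfl i
  have hbb (i) : ⟪b i, b i⟫ = 1 := by
    rw [real_inner_self_eq_norm_sq, b.norm_eq_one, one_pow]
  have hl (i) : l i ∈ Icc (0 : ℝ) 1 := by
    have h0 := hT0 (b i)
    have h1 := hT1 (b i)
    rw [hTb, inner_smul_left, hbb] at h0 h1
    simpa using And.intro h0 h1
  refine (IsHarmonicMixture.sum Finset.univ (f := fun i x =>
    ⟪p, b i⟫ ^ 2 * harmonicKernel x ⟨l i, hl i⟩)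
    fun i _ => (IsHarmonicMixture.kernel _).const_mul (sq_nonneg _)).congr fun x hx => ?_
  rw [← b.sum_inner_mul_inner, Finset.mul_sum]
  refine Finset.sum_congr rfl fun i _ => ?_
  have hd := harmonicKernel_denom_pos hx ⟨l i, hl i⟩
  have key : ⟪p, b i⟫ = (1 + (x - 1) * l i) * ⟪b i, r x⟫ := by
    conv_lhs => rw [← hr x hx]
    rw [inner_add_left, inner_smul_left, hT, hTb, inner_smul_right, real_inner_comm (b i) (r x)]
    simp; ring
  simp only [harmonicKernel]
  rw [key]
  field_simp

/-- The Schur-complement type expression attached to a diagonal pencil is a harmonic mixture. -/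
lemma isHarmonicMixture_schur {ι : Type*} [Fintype ι] (u : ι → unitInterval)
    (v w : EuclideanSpace ℝ ι) (hv : v ≠ 0) :
    IsHarmonicMixture fun x => x * ((∑ i, w i ^ 2 / (1 + (x - 1) * u i)) -
      (∑ i, v i * w i / (1 + (x - 1) * u i)) ^ 2 / ∑ i, v i ^ 2 / (1 + (x - 1) * u i)) := by
  let D : EuclideanSpace ℝ ι →ₗ[ℝ] EuclideanSpace ℝ ι :=
    { toFun := fun z => WithLp.toLp 2 fun i => (u i : ℝ) * z i
      map_add' := fun a b => by ext i; simp [mul_add]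
      map_smul' := fun a b => by ext i; simp; ring }
  have hD (z i) : D z i = u i * z i := rfl
  let K := (ℝ ∙ v)ᗮ
  let P : EuclideanSpace ℝ ι →ₗ[ℝ] EuclideanSpace ℝ ι := K.starProjection.toLinearMap
  have hPs (a b) : ⟪P a, b⟫ = ⟪a, P b⟫ := K.inner_starProjection_left_eq_right a b
  have hPv : P v = 0 := by
    refine K.starProjection_apply_eq_zero_iff.2 ?_
    exact Submodule.le_orthogonal_orthogonal _ (Submodule.mem_span_singleton_self v)
  have hPn (z) : ⟪P z, P z⟫ ≤ ⟪z, z⟫ := by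
    rw [real_inner_self_eq_norm_sq, real_inner_self_eq_norm_sq]
    gcongr
    exact K.norm_starProjection_apply_le z
  have hDs (a b) : ⟪D a, b⟫ = ⟪a, D b⟫ := by
    simp only [PiLp.inner_apply, hD]
    exact Finset.sum_congr rfl fun i _ => by simp; ring
  have hD0 (z) : 0 ≤ ⟪D z, z⟫ := by
    simp only [PiLp.inner_apply, hD]
    refine Finset.sum_nonneg fun i _ => ?_
    have := (u i).2.1
    simp only [RCLike.inner_apply, conj_trivial]
    nlinarith [mul_nonneg this (sq_nonneg (z i))]
  have hD1 (z) : ⟪D z, z⟫ ≤ ⟪z, z⟫ := by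
    simp only [PiLp.inner_apply, hD]
    refine Finset.sum_le_sum fun i _ => ?_
    have := (u i).2.2
    simp only [RCLike.inner_apply, conj_trivial]
    nlinarith [mul_nonneg (sub_nonneg.2 this) (sq_nonneg (z i))]
  let T := P ∘ₗ D ∘ₗ P
  have hTz (a b) : ⟪T a, b⟫ = ⟪D (P a), P b⟫ := hPs _ _
  let R (x : ℝ) (z : EuclideanSpace ℝ ι) : EuclideanSpace ℝ ι :=
    WithLp.toLp 2 fun i => z i / (1 + (x - 1) * u i)
  have hR (x : ℝ) (a b) : ⟪a, R x b⟫ = ∑ i, a i * b i / (1 + (x - 1) * u i) := by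
    simp only [PiLp.inner_apply, R]
    exact Finset.sum_congr rfl fun i _ => by simp; ring
  let c (x : ℝ) : ℝ := ⟪v, R x w⟫ / ⟪v, R x v⟫
  have hRv (x : ℝ) (hx : 0 < x) : 0 < ⟪v, R x v⟫ := by
    rw [hR]
    obtain ⟨i, hi⟩ : ∃ i, v i ≠ 0 := by
      by_contra! h
      exact hv (by ext i; simpa using h i)
    refine Finset.sum_pos' (fun j _ => div_nonneg (mul_self_nonneg _)
      (harmonicKernel_denom_pos hx _).le) ⟨i, Finset.mem_univ i, ?_⟩
    exact div_pos (mul_self_pos.2 hi) (harmonicKernel_denom_pos hx _)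
  let r (x : ℝ) : EuclideanSpace ℝ ι := R x w - c x • R x v
  have hvr (x : ℝ) (hx : 0 < x) : ⟪v, r x⟫ = 0 := by
    simp only [r, c, inner_sub_right, inner_smul_right]
    rw [div_mul_cancel₀ _ (hRv x hx).ne', sub_self]
  have hPr (x : ℝ) (hx : 0 < x) : P (r x) = r x :=
    K.starProjection_eq_self_iff.2 (Submodule.mem_orthogonal_singleton_iff_inner_right.2
      (hvr x hx))
  have hDr (x : ℝ) (hx : 0 < x) : r x + (x - 1) • D (r x) = w - c x • v := by
    ext i
    have := (harmonicKernel_denom_pos hx (u i)).ne'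
    simp only [r, R, PiLp.add_apply, PiLp.smul_apply, hD, PiLp.sub_apply, smul_eq_mul]
    field_simp
  refine (isHarmonicMixture_resolvent (T := T) (fun a b => ?_) (fun z => ?_) (fun z => ?_) (P w) r
    fun x hx => ?_).congr fun x hx => ?_
  · rw [hTz, real_inner_comm (T b), hTz, hDs, real_inner_comm]
  · rw [hTz]; exact hD0 _
  · rw [hTz]; exact (hD1 _).trans (hPn z)
  · have := congrArg P (hDr x hx)
    simp only [map_add, map_smul, map_sub, hPv, smul_zero, sub_zero] at this
    rw [← this]
    simp only [T, LinearMap.comp_apply, hPr x hx]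
  · rw [hPs, hPr x hx]
    simp only [r, c, inner_sub_right, inner_smul_right, hR]
    simp only [pow_two, mul_comm (w _) (v _)]
    ring

lemma isHarmonicMixture_parallel_of_finite {ι κ : Type*} [Fintype ι] [Fintype κ]
    (u : ι → unitInterval) (u' : κ → unitInterval) {c : ι → ℝ} {d : κ → ℝ} (hc : ∀ i, 0 ≤ c i)
    (hd : ∀ i, 0 ≤ d i) :
    IsHarmonicMixture fun x =>
      (∑ i, c i * harmonicKernel x (u i)) * (∑ i, d i * harmonicKernel x (u' i)) /
      (∑ i, c i * harmonicKernel x (u i) + ∑ i, d i * harmonicKernel x (u' i)) := by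
  by_cases hv : (∀ i, c i = 0) ∧ ∀ i, d i = 0
  · exact IsHarmonicMixture.zero.congr fun x _ => by simp [hv.1]
  let v : EuclideanSpace ℝ (ι ⊕ κ) :=
    WithLp.toLp 2 (Sum.elim (fun i => √(c i)) fun i => √(d i))
  let w : EuclideanSpace ℝ (ι ⊕ κ) := WithLp.toLp 2 (Sum.elim (fun i => √(c i)) fun i => 0)
  have hv0 : v ≠ 0 := by
    intro h
    refine hv ⟨fun i => ?_, fun i => ?_⟩
    · have : √(c i) = 0 := congrArg (fun z : EuclideanSpace ℝ (ι ⊕ κ) => z (Sum.inl i)) h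
      exact (Real.sqrt_eq_zero (hc i)).1 this
    · have : √(d i) = 0 := congrArg (fun z : EuclideanSpace ℝ (ι ⊕ κ) => z (Sum.inr i)) h
      exact (Real.sqrt_eq_zero (hd i)).1 this
  refine (isHarmonicMixture_schur (Sum.elim u u') v w hv0).congr fun x hx => ?_
  have e1 : ∑ i, c i * harmonicKernel x (u i) = x * ∑ i, c i / (1 + (x - 1) * u i) := by
    rw [Finset.mul_sum]
    exact Finset.sum_congr rfl fun i _ => by simp only [harmonicKernel]; ring
  have e2 : ∑ i, d i * harmonicKernel x (u' i) = x * ∑ i, d i / (1 + (x - 1) * u' i) := by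
    rw [Finset.mul_sum]
    exact Finset.sum_congr rfl fun i _ => by simp only [harmonicKernel]; ring
  have hs : 0 < ∑ i, c i / (1 + (x - 1) * u i) + ∑ i, d i / (1 + (x - 1) * u' i) := by
    have h1 (i) : 0 ≤ c i / (1 + (x - 1) * u i) :=
      div_nonneg (hc i) (harmonicKernel_denom_pos hx _).le
    have h2 (i) : 0 ≤ d i / (1 + (x - 1) * u' i) :=
      div_nonneg (hd i) (harmonicKernel_denom_pos hx _).le
    rcases not_and_or.1 hv with h | h <;> push Not at h <;> obtain ⟨i, hi⟩ := h
    · refine add_pos_of_pos_of_nonneg (Finset.sum_pos' (fun j _ => h1 j) ⟨i, Finset.mem_univ i, ?_⟩)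
        (Finset.sum_nonneg fun j _ => h2 j)
      exact div_pos ((hc i).lt_of_ne' hi) (harmonicKernel_denom_pos hx _)
    · refine add_pos_of_nonneg_of_pos (Finset.sum_nonneg fun j _ => h1 j)
        (Finset.sum_pos' (fun j _ => h2 j) ⟨i, Finset.mem_univ i, ?_⟩)
      exact div_pos ((hd i).lt_of_ne' hi) (harmonicKernel_denom_pos hx _)
  rw [e1, e2]
  simp only [v, w, Fintype.sum_sum_type, Sum.elim_inl, Sum.elim_inr, Real.sq_sqrt (hc _),
    Real.sq_sqrt (hd _), Real.mul_self_sqrt (hc _), mul_zero, zero_div, Finset.sum_const_zero,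
    add_zero, ne_eq, OfNat.ofNat_ne_zero, not_false_eq_true, zero_pow]
  generalize ∑ i, c i / (1 + (x - 1) * u i) = a at *
  generalize ∑ i, d i / (1 + (x - 1) * u' i) = b at *
  field_simp
  ring

/-- The grid point `j / (n + 1)` of the unit interval. -/
noncomputable def unitGrid (n : ℕ) (j : Fin (n + 2)) : unitInterval :=
  ⟨j / (n + 1), by positivity, by
    rw [div_le_one (by positivity)]; exact_mod_cast Nat.le_of_lt_succ j.2⟩

lemma IsHarmonicMixture.exists_finite_approx {f : ℝ → ℝ} (hf : IsHarmonicMixture f) :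
    ∃ c : (n : ℕ) → Fin (n + 2) → ℝ, (∀ n j, 0 ≤ c n j) ∧ ∀ x, 0 < x →
      Tendsto (fun n => ∑ j, c n j * harmonicKernel x (unitGrid n j)) atTop (nhds (f x)) := by
  obtain ⟨ν, hν⟩ := hf
  let q (n : ℕ) (u : unitInterval) : Fin (n + 2) := Fin.ofNat (n + 2) ⌊(n + 1 : ℝ) * u⌋₊
  have hq (n : ℕ) : Measurable (q n) :=
    (measurable_from_nat (f := Fin.ofNat (n + 2))).comp
      (Nat.measurable_floor.comp (by fun_prop))
  have hqv (n : ℕ) (u : unitInterval) :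
      (unitGrid n (q n u) : ℝ) = ⌊(n + 1 : ℝ) * u⌋₊ / (n + 1) := by
    have : ⌊(n + 1 : ℝ) * u⌋₊ < n + 2 := by
      rw [Nat.floor_lt (mul_nonneg (by positivity) u.2.1)]
      push_cast
      nlinarith [u.2.2, u.2.1, (Nat.cast_nonneg n : (0 : ℝ) ≤ n)]
    simp [unitGrid, q, Nat.mod_eq_of_lt this]
  refine ⟨fun n j => (Measure.map (q n) (ν : Measure unitInterval)).real {j},
    fun n j => measureReal_nonneg, fun x hx => ?_⟩
  have hcont := continuous_harmonicKernel hx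
  have e (n : ℕ) : ∑ j, (Measure.map (q n) (ν : Measure unitInterval)).real {j} *
      harmonicKernel x (unitGrid n j) =
      ∫ u, harmonicKernel x (unitGrid n (q n u)) ∂(ν : Measure unitInterval) := by
    have : IsFiniteMeasure (Measure.map (q n) (ν : Measure unitInterval)) := inferInstance
    rw [← integral_map (φ := q n) (f := fun j => harmonicKernel x (unitGrid n j))
      (hq n).aemeasurable (measurable_of_finite _).aestronglyMeasurable,
      integral_fintype (Integrable.of_finite)]
    simp
  simp only [e]
  rw [hν x hx]
  refine tendsto_integral_of_dominated_convergence (fun _ => ‖harmonicKernelBCF hx‖)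
    (fun n => (((measurable_of_finite (fun j => harmonicKernel x (unitGrid n j))).comp
      (hq n))).aestronglyMeasurable) (integrable_const _)
    (fun n => ae_of_all _ fun u => (harmonicKernelBCF hx).norm_coe_le_norm _)
    (ae_of_all _ fun u => ?_)
  refine (hcont.tendsto u).comp (tendsto_subtype_rng.2 ?_)
  simp only [hqv]
  have h := (tendsto_nat_floor_mul_div_atTop (R := ℝ) u.2.1).comp
    (tendsto_atTop_add_const_right _ (1 : ℝ) tendsto_natCast_atTop_atTop)
  refine h.congr fun n => ?_
  simp [mul_comm]

/-- The parallel sum of two harmonic mixtures is a harmonic mixture. -/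
lemma IsHarmonicMixture.parallel {f g : ℝ → ℝ} (hf : IsHarmonicMixture f)
    (hg : IsHarmonicMixture g) (hpos : ∀ x, 0 < x → f x + g x ≠ 0) :
    IsHarmonicMixture fun x => f x * g x / (f x + g x) := by
  obtain ⟨c, hc, hcf⟩ := hf.exists_finite_approx
  obtain ⟨d, hd, hdg⟩ := hg.exists_finite_approx
  exact .of_tendsto
    (fun n => isHarmonicMixture_parallel_of_finite (unitGrid n) (unitGrid n) (hc n) (hd n))
    fun x hx => ((hcf x hx).mul (hdg x hx)).div ((hcf x hx).add (hdg x hx)) (hpos x hx)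

/-! ### Geometric means -/

/-- One step of the arithmetic-harmonic mean iteration. -/
noncomputable def arithHarmStep (p : ℝ × ℝ) : ℝ × ℝ :=
  ((p.1 + p.2) / 2, 2 * (p.1 * p.2 / (p.1 + p.2)))

lemma arithHarmStep_iterate {a b : ℝ} (ha : 0 < a) (hb : 0 < b) (n : ℕ) :
    0 < (arithHarmStep^[n] (a, b)).1 ∧ 0 < (arithHarmStep^[n] (a, b)).2 ∧
    (arithHarmStep^[n] (a, b)).1 * (arithHarmStep^[n] (a, b)).2 = a * b ∧
    |(arithHarmStep^[n] (a, b)).1 - (arithHarmStep^[n] (a, b)).2| ≤ |a - b| * (1 / 2) ^ n := by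
  induction n with
  | zero => simp [ha, hb]
  | succ n ih =>
    rw [Function.iterate_succ_apply']
    generalize arithHarmStep^[n] (a, b) = p at *
    obtain ⟨s, t⟩ := p
    obtain ⟨hs, ht, hst, hd⟩ := ih
    simp only [arithHarmStep] at *
    refine ⟨by positivity, by positivity, by rw [← hst]; field_simp, ?_⟩
    have e : (s + t) / 2 - 2 * (s * t / (s + t)) = (s - t) * (s - t) / (s + t) / 2 := by
      field_simp; ring
    have h1 : |s - t| * |s - t| / (s + t) ≤ |s - t| := by
      rw [div_le_iff₀ (by positivity)]
      gcongr
      rw [abs_le]; constructor <;> linarith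
    rw [e, abs_div, abs_div, abs_mul, abs_of_pos (add_pos hs ht), abs_two, pow_succ]
    linarith

lemma tendsto_arithHarmStep_iterate {a b : ℝ} (ha : 0 < a) (hb : 0 < b) :
    Tendsto (fun n => (arithHarmStep^[n] (a, b)).1) atTop (nhds √(a * b)) := by
  rw [tendsto_iff_dist_tendsto_zero]
  refine squeeze_zero (g := fun n => |a - b| * (1 / 2) ^ n) (fun _ => dist_nonneg) (fun n => ?_) ?_
  · obtain ⟨hs, ht, hst, hd⟩ := arithHarmStep_iterate ha hb n
    refine le_trans ?_ hd
    rw [← hst, Real.dist_eq]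
    generalize (arithHarmStep^[n] (a, b)).1 = s at *
    generalize (arithHarmStep^[n] (a, b)).2 = t at *
    rcases le_total s t with h | h
    · rw [abs_of_nonpos (a := s - t) (by linarith), abs_of_nonpos]
      · have : √(s * t) ≤ t := Real.sqrt_le_iff.2 ⟨ht.le, by nlinarith⟩
        linarith
      · have : s ≤ √(s * t) := Real.le_sqrt_of_sq_le (by nlinarith)
        linarith
    · rw [abs_of_nonneg (a := s - t) (by linarith), abs_of_nonneg]
      · have : t ≤ √(s * t) := Real.le_sqrt_of_sq_le (by nlinarith)
        linarith
      · have : √(s * t) ≤ s := Real.sqrt_le_iff.2 ⟨hs.le, by nlinarith⟩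
        linarith
  · simpa using (tendsto_pow_atTop_nhds_zero_of_lt_one (r := (1 / 2 : ℝ)) (by norm_num)
      (by norm_num)).const_mul |a - b|

lemma IsHarmonicMixture.sqrt_mul {f g : ℝ → ℝ} (hf : IsHarmonicMixture f)
    (hg : IsHarmonicMixture g) (hf0 : ∀ x, 0 < x → 0 < f x) (hg0 : ∀ x, 0 < x → 0 < g x) :
    IsHarmonicMixture fun x => √(f x * g x) := by
  have key (n : ℕ) : IsHarmonicMixture (fun x => (arithHarmStep^[n] (f x, g x)).1) ∧
      IsHarmonicMixture (fun x => (arithHarmStep^[n] (f x, g x)).2) := by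
    induction n with
    | zero => exact ⟨hf, hg⟩
    | succ n ih =>
      simp only [Function.iterate_succ_apply']
      refine ⟨((ih.1.add ih.2).const_mul (c := 1 / 2) (by norm_num)).congr fun x _ => ?_,
        (ih.1.parallel ih.2 fun x hx => ?_).const_mul zero_le_two⟩
      · simp only [arithHarmStep]; ring
      · have h := arithHarmStep_iterate (hf0 x hx) (hg0 x hx) n
        exact (add_pos h.1 h.2.1).ne'
  exact .of_tendsto (fun n => (key n).1) fun x hx =>
    tendsto_arithHarmStep_iterate (hf0 x hx) (hg0 x hx)

lemma sqrt_rpow_mul_rpow {a b : ℝ} (ha : 0 < a) (hb : 0 < b) (α β : ℝ) :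
    √(a ^ α * b ^ (1 - α) * (a ^ β * b ^ (1 - β))) =
      a ^ ((α + β) / 2) * b ^ (1 - (α + β) / 2) := by
  have e : a ^ α * b ^ (1 - α) * (a ^ β * b ^ (1 - β)) =
      (a ^ ((α + β) / 2) * b ^ (1 - (α + β) / 2)) ^ 2 := by
    rw [mul_pow, ← Real.rpow_mul_natCast ha.le, ← Real.rpow_mul_natCast hb.le,
      mul_mul_mul_comm, ← Real.rpow_add ha, ← Real.rpow_add hb]
    congr 2 <;> push_cast <;> ring
  rw [e, Real.sqrt_sq (by positivity)]

lemma IsHarmonicMixture.rpow_mul_rpow_dyadic {f g : ℝ → ℝ} (hf : IsHarmonicMixture f)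
    (hg : IsHarmonicMixture g) (hf0 : ∀ x, 0 < x → 0 < f x) (hg0 : ∀ x, 0 < x → 0 < g x)
    (n j : ℕ) (hj : j ≤ 2 ^ n) :
    IsHarmonicMixture fun x => f x ^ ((j : ℝ) / 2 ^ n) * g x ^ (1 - (j : ℝ) / 2 ^ n) := by
  induction n generalizing j with
  | zero =>
    have : j = 0 ∨ j = 1 := by simp at hj; omega
    rcases this with rfl | rfl
    · simpa using hg
    · simpa using hf
  | succ n ih =>
    have mid (i k : ℕ) (hi : i ≤ 2 ^ n) (hk : k ≤ 2 ^ n) (hik : j = i + k) :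
        IsHarmonicMixture fun x =>
          f x ^ ((j : ℝ) / 2 ^ (n + 1)) * g x ^ (1 - (j : ℝ) / 2 ^ (n + 1)) := by
      refine ((ih i hi).sqrt_mul (ih k hk) (fun x hx => ?_) fun x hx => ?_).congr fun x hx => ?_
      · exact mul_pos (Real.rpow_pos_of_pos (hf0 x hx) _) (Real.rpow_pos_of_pos (hg0 x hx) _)
      · exact mul_pos (Real.rpow_pos_of_pos (hf0 x hx) _) (Real.rpow_pos_of_pos (hg0 x hx) _)
      · have e : (j : ℝ) / 2 ^ (n + 1) = ((i : ℝ) / 2 ^ n + (k : ℝ) / 2 ^ n) / 2 := by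
          rw [hik, pow_succ]; push_cast; field_simp
        rw [sqrt_rpow_mul_rpow (hf0 x hx) (hg0 x hx), e]
    rw [pow_succ] at hj
    exact mid (j / 2) (j - j / 2) (by omega) (by omega) (by omega)

lemma IsHarmonicMixture.rpow_mul_rpow {f g : ℝ → ℝ} (hf : IsHarmonicMixture f)
    (hg : IsHarmonicMixture g) {α : ℝ} (hα0 : 0 < α) (hα1 : α < 1) :
    IsHarmonicMixture fun x => f x ^ α * g x ^ (1 - α) := by
  rcases hf.eq_zero_or_pos with hf0 | hf0
  · exact IsHarmonicMixture.zero.congr fun x hx => by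
      rw [hf0 x hx, Real.zero_rpow hα0.ne', zero_mul]
  rcases hg.eq_zero_or_pos with hg0 | hg0
  · exact IsHarmonicMixture.zero.congr fun x hx => by
      rw [hg0 x hx, Real.zero_rpow (sub_pos.2 hα1).ne', mul_zero]
  have hfloor (n : ℕ) : ⌊α * 2 ^ n⌋₊ ≤ 2 ^ n := by
    refine Nat.floor_le_of_le ?_
    push_cast
    exact mul_le_of_le_one_left (by positivity) hα1.le
  have hlim : Tendsto (fun n : ℕ => (⌊α * 2 ^ n⌋₊ : ℝ) / 2 ^ n) atTop (nhds α) :=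
    (tendsto_nat_floor_mul_div_atTop hα0.le).comp (tendsto_pow_atTop_atTop_of_one_lt one_lt_two)
  refine .of_tendsto (fun n => hf.rpow_mul_rpow_dyadic hg hf0 hg0 n _ (hfloor n)) fun x hx => ?_
  exact ((Real.continuousAt_const_rpow (hf0 x hx).ne').tendsto.comp hlim).mul
    ((Real.continuousAt_const_rpow (hg0 x hx).ne').tendsto.comp (tendsto_const_nhds.sub hlim))

/-! ### Mixtures of extremal Bernstein functions -/

/-- The extremal Bernstein function with `x² ∫₀^∞ e^{-xt} bernsteinKernel t u dt` equal to
`harmonicKernel x u`. -/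
noncomputable def bernsteinKernel (t : ℝ) (u : unitInterval) : ℝ :=
  if (u : ℝ) = 0 then 1 else if (u : ℝ) = 1 then t else
    (1 - Real.exp (-((1 - u) / u * t))) / (1 - u)

/-- Up to sign, the derivative of order `m + 1` of `bernsteinKernel · u` at `t`. -/
noncomputable def bernsteinKernelDeriv (m : ℕ) (t : ℝ) (u : unitInterval) : ℝ :=
  ((1 - u) / u) ^ m * Real.exp (-((1 - u) / u * t)) / u

lemma hasDerivAt_bernsteinKernel (t : ℝ) (u : unitInterval) :
    HasDerivAt (fun t => bernsteinKernel t u) (bernsteinKernelDeriv 0 t u) t := by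
  unfold bernsteinKernel bernsteinKernelDeriv
  by_cases h0 : (u : ℝ) = 0
  · simp only [h0, if_true, div_zero]; exact hasDerivAt_const _ _
  by_cases h1 : (u : ℝ) = 1
  · simpa [h1] using hasDerivAt_id' t
  have h1' : (1 - u : ℝ) ≠ 0 := sub_ne_zero.2 (Ne.symm h1)
  simp only [h0, h1, if_false]
  refine ((((hasDerivAt_id' t).const_mul ((1 - u : ℝ) / u)).neg.exp).const_sub 1).div_const
    (1 - u : ℝ) |>.congr_deriv ?_
  simp only [Pi.neg_apply]
  field_simp

lemma hasDerivAt_bernsteinKernelDeriv (m : ℕ) (t : ℝ) (u : unitInterval) :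
    HasDerivAt (fun t => bernsteinKernelDeriv m t u) (-bernsteinKernelDeriv (m + 1) t u) t := by
  unfold bernsteinKernelDeriv
  refine ((((hasDerivAt_id' t).const_mul ((1 - u : ℝ) / u)).neg.exp).const_mul
    (((1 - u : ℝ) / u) ^ m)).div_const (u : ℝ) |>.congr_deriv ?_
  simp only [Pi.neg_apply]
  ring

lemma bernsteinKernel_nonneg {t : ℝ} (ht : 0 ≤ t) (u : unitInterval) :
    0 ≤ bernsteinKernel t u := by
  have h0 := u.2.1
  have h1 := u.2.2
  unfold bernsteinKernel
  split_ifs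
  · exact zero_le_one
  · exact ht
  · refine div_nonneg (sub_nonneg.2 (Real.exp_le_one_iff.2 ?_)) (by linarith)
    have : 0 ≤ (1 - u : ℝ) / u * t := mul_nonneg (div_nonneg (by linarith) h0) ht
    linarith

lemma bernsteinKernel_le {t : ℝ} (ht : 0 ≤ t) (u : unitInterval) :
    bernsteinKernel t u ≤ 1 + t := by
  have h0 := u.2.1
  have h1 := u.2.2
  unfold bernsteinKernel
  split_ifs with hu0 hu1
  · linarith
  · linarith
  · have h1' : (0 : ℝ) < 1 - u := sub_pos.2 (h1.lt_of_ne hu1)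
    have h0' : (0 : ℝ) < u := h0.lt_of_ne' hu0
    rw [div_le_iff₀ h1']
    have e1 := Real.add_one_le_exp (-((1 - u : ℝ) / u * t))
    have e2 := Real.exp_pos (-((1 - u : ℝ) / u * t))
    have e3 : (u : ℝ) * ((1 - u : ℝ) / u * t) = (1 - u) * t := by field_simp
    generalize (1 - u : ℝ) / u * t = y at *
    nlinarith

lemma bernsteinKernelDeriv_nonneg (m : ℕ) (t : ℝ) (u : unitInterval) :
    0 ≤ bernsteinKernelDeriv m t u := by
  have h0 := u.2.1
  have h1 : (0 : ℝ) ≤ 1 - u := sub_nonneg.2 u.2.2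
  unfold bernsteinKernelDeriv
  positivity

lemma pow_mul_exp_neg_le {ε s : ℝ} (hε : 0 < ε) (hs : 0 ≤ s) (m : ℕ) :
    s ^ m * Real.exp (-(s * ε)) ≤ m.factorial / ε ^ m := by
  have h := Real.pow_div_factorial_le_exp (s * ε) (by positivity) m
  rw [div_le_iff₀ (by positivity), mul_pow] at h
  rw [le_div_iff₀ (by positivity), Real.exp_neg]
  calc s ^ m * (Real.exp (s * ε))⁻¹ * ε ^ m = s ^ m * ε ^ m * (Real.exp (s * ε))⁻¹ := by ring
    _ ≤ Real.exp (s * ε) * m.factorial * (Real.exp (s * ε))⁻¹ := by gcongr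
    _ = m.factorial := by field_simp

lemma bernsteinKernelDeriv_le (m : ℕ) {ε t : ℝ} (hε : 0 < ε) (ht : ε ≤ t) (u : unitInterval) :
    bernsteinKernelDeriv m t u ≤ m.factorial / ε ^ m + (m + 1).factorial / ε ^ (m + 1) := by
  have h0 := u.2.1
  have h1 : (0 : ℝ) ≤ 1 - u := sub_nonneg.2 u.2.2
  unfold bernsteinKernelDeriv
  rcases h0.eq_or_lt with hu | hu
  · rw [← hu, div_zero]; positivity
  have hs : 0 ≤ (1 - u : ℝ) / u := by positivity
  have e : (1 : ℝ) / u = 1 + (1 - u) / u := by field_simp; ring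
  rw [div_eq_mul_one_div, e]
  generalize (1 - u : ℝ) / u = s at *
  calc s ^ m * Real.exp (-(s * t)) * (1 + s) ≤ s ^ m * Real.exp (-(s * ε)) * (1 + s) := by
        gcongr
    _ = s ^ m * Real.exp (-(s * ε)) + s ^ (m + 1) * Real.exp (-(s * ε)) := by ring
    _ ≤ _ := add_le_add (pow_mul_exp_neg_le hε hs m) (pow_mul_exp_neg_le hε hs (m + 1))

lemma measurable_bernsteinKernel :
    Measurable fun p : ℝ × unitInterval => bernsteinKernel p.1 p.2 := by
  unfold bernsteinKernel
  refine Measurable.ite (measurableSet_eq_fun (by fun_prop) measurable_const) measurable_const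
    (Measurable.ite (measurableSet_eq_fun (by fun_prop) measurable_const) measurable_fst ?_)
  fun_prop

lemma measurable_bernsteinKernelDeriv (m : ℕ) (t : ℝ) : Measurable (bernsteinKernelDeriv m t) := by
  unfold bernsteinKernelDeriv
  fun_prop

lemma measurable_bernsteinKernel_right (t : ℝ) : Measurable (bernsteinKernel t) :=
  measurable_bernsteinKernel.comp measurable_prodMk_left

lemma integrable_bernsteinKernel {t : ℝ} (ht : 0 ≤ t) (ν : Measure unitInterval)
    [IsFiniteMeasure ν] : Integrable (bernsteinKernel t) ν :=
  (integrable_const (1 + t)).mono'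
    (measurable_bernsteinKernel_right _).aestronglyMeasurable
    (ae_of_all _ fun u => by
      rw [Real.norm_of_nonneg (bernsteinKernel_nonneg ht u)]; exact bernsteinKernel_le ht u)

lemma integrable_bernsteinKernelDeriv (m : ℕ) {t : ℝ} (ht : 0 < t) (ν : Measure unitInterval)
    [IsFiniteMeasure ν] : Integrable (bernsteinKernelDeriv m t) ν :=
  (integrable_const (m.factorial / t ^ m + (m + 1).factorial / t ^ (m + 1) : ℝ)).mono'
    (measurable_bernsteinKernelDeriv m t).aestronglyMeasurable
    (ae_of_all _ fun u => by
      rw [Real.norm_of_nonneg (bernsteinKernelDeriv_nonneg m t u)]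
      exact bernsteinKernelDeriv_le m ht le_rfl u)

lemma hasDerivAt_integral_bernsteinKernel {t : ℝ} (ht : 0 < t) (ν : Measure unitInterval)
    [IsFiniteMeasure ν] : HasDerivAt (fun t => ∫ u, bernsteinKernel t u ∂ν)
      (∫ u, bernsteinKernelDeriv 0 t u ∂ν) t := by
  have hε : 0 < t / 2 := by linarith
  refine (hasDerivAt_integral_of_dominated_loc_of_deriv_le (F := bernsteinKernel)
    (F' := bernsteinKernelDeriv 0)
    (bound := fun _ => (Nat.factorial 0 / (t / 2) ^ 0 + Nat.factorial 1 / (t / 2) ^ 1 : ℝ))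
    (Ioi_mem_nhds (half_lt_self ht)) (Eventually.of_forall fun s =>
      (measurable_bernsteinKernel_right _).aestronglyMeasurable)
    (integrable_bernsteinKernel ht.le ν)
    (measurable_bernsteinKernelDeriv 0 t).aestronglyMeasurable (ae_of_all _ fun u s hs => ?_)
    (integrable_const _) (ae_of_all _ fun u s _ => hasDerivAt_bernsteinKernel s u)).2
  rw [Real.norm_of_nonneg (bernsteinKernelDeriv_nonneg _ _ u)]
  exact bernsteinKernelDeriv_le 0 hε (le_of_lt hs) u

lemma hasDerivAt_integral_bernsteinKernelDeriv (m : ℕ) {t : ℝ} (ht : 0 < t)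
    (ν : Measure unitInterval) [IsFiniteMeasure ν] :
    HasDerivAt (fun t => ∫ u, bernsteinKernelDeriv m t u ∂ν)
      (-∫ u, bernsteinKernelDeriv (m + 1) t u ∂ν) t := by
  have hε : 0 < t / 2 := by linarith
  rw [← integral_neg]
  refine (hasDerivAt_integral_of_dominated_loc_of_deriv_le (F := bernsteinKernelDeriv m)
    (F' := fun s u => -bernsteinKernelDeriv (m + 1) s u)
    (bound := fun _ =>
      ((m + 1).factorial / (t / 2) ^ (m + 1) + (m + 2).factorial / (t / 2) ^ (m + 2) : ℝ))
    (Ioi_mem_nhds (half_lt_self ht))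
    (Eventually.of_forall fun s => (measurable_bernsteinKernelDeriv m s).aestronglyMeasurable)
    (integrable_bernsteinKernelDeriv m ht ν)
    (measurable_bernsteinKernelDeriv (m + 1) t).neg.aestronglyMeasurable
    (ae_of_all _ fun u s hs => ?_)
    (integrable_const _) (ae_of_all _ fun u s _ => hasDerivAt_bernsteinKernelDeriv m s u)).2
  rw [norm_neg, Real.norm_of_nonneg (bernsteinKernelDeriv_nonneg _ _ u)]
  exact bernsteinKernelDeriv_le (m + 1) hε (le_of_lt hs) u

lemma iteratedDerivWithin_integral_bernsteinKernel (ν : Measure unitInterval)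
    [IsFiniteMeasure ν] (m : ℕ) {t : ℝ} (ht : 0 < t) :
    iteratedDerivWithin (m + 1) (fun t => ∫ u, bernsteinKernel t u ∂ν) (Ioi 0) t =
      (-1) ^ m * ∫ u, bernsteinKernelDeriv m t u ∂ν := by
  induction m generalizing t with
  | zero =>
    rw [zero_add, iteratedDerivWithin_one,
      (hasDerivAt_integral_bernsteinKernel ht ν).hasDerivWithinAt.derivWithin
        (isOpen_Ioi.uniqueDiffWithinAt ht)]
    simp
  | succ m ih =>
    have h : EqOn (iteratedDerivWithin (m + 1) (fun t => ∫ u, bernsteinKernel t u ∂ν) (Ioi 0))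
        (fun t => (-1) ^ m * ∫ u, bernsteinKernelDeriv m t u ∂ν) (Ioi 0) := fun s hs => ih hs
    rw [iteratedDerivWithin_succ, derivWithin_congr h (h ht),
      ((hasDerivAt_integral_bernsteinKernelDeriv m ht ν).const_mul
        ((-1) ^ m)).hasDerivWithinAt.derivWithin (isOpen_Ioi.uniqueDiffWithinAt ht)]
    ring

lemma isBernstein_integral_bernsteinKernel (ν : Measure unitInterval) [IsFiniteMeasure ν] :
    IsBernstein fun t => ∫ u, bernsteinKernel t u ∂ν := by
  refine ⟨fun t ht => integral_nonneg fun u => bernsteinKernel_nonneg ht u, fun t ht => ?_, ?_, ?_⟩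
  · refine continuousWithinAt_of_dominated (bound := fun _ => 2 + t)
      (Eventually.of_forall fun s =>
        (measurable_bernsteinKernel_right _).aestronglyMeasurable) ?_
      (integrable_const _)
      (ae_of_all _ fun u => (hasDerivAt_bernsteinKernel t u).continuousAt.continuousWithinAt)
    filter_upwards [self_mem_nhdsWithin,
      mem_nhdsWithin_of_mem_nhds (Iio_mem_nhds (lt_add_one t))] with s hs hst
    refine ae_of_all _ fun u => ?_
    rw [Real.norm_of_nonneg (bernsteinKernel_nonneg hs u)]
    have hst' : s < t + 1 := hst
    linarith [bernsteinKernel_le hs u]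
  · refine contDiffOn_of_differentiableOn_deriv fun m _ => ?_
    rcases m with _ | m
    · simp only [iteratedDerivWithin_zero]
      exact fun t ht => (hasDerivAt_integral_bernsteinKernel ht
        ν).differentiableAt.differentiableWithinAt
    · refine DifferentiableOn.congr (fun t ht => ?_)
        fun t ht => iteratedDerivWithin_integral_bernsteinKernel ν m ht
      exact ((hasDerivAt_integral_bernsteinKernelDeriv m ht ν).const_mul
        ((-1) ^ m)).differentiableAt.differentiableWithinAt
  · intro n hn t ht
    obtain ⟨m, rfl⟩ := Nat.exists_eq_add_of_le' hn
    rw [iteratedDerivWithin_integral_bernsteinKernel ν m ht, Nat.add_sub_cancel, ← mul_assoc,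
      ← mul_pow]
    norm_num
    exact integral_nonneg fun u => bernsteinKernelDeriv_nonneg m t u

lemma integral_exp_neg_mul_bernsteinKernel {x : ℝ} (hx : 0 < x) (u : unitInterval) :
    ∫ t in Ioi (0 : ℝ), Real.exp (-x * t) * bernsteinKernel t u = harmonicKernel x u / x ^ 2 := by
  have hexp {a : ℝ} (ha : 0 < a) : ∫ t in Ioi (0 : ℝ), Real.exp (-a * t) = 1 / a := by
    rw [integral_exp_mul_Ioi (by linarith)]; simp
  unfold bernsteinKernel harmonicKernel
  by_cases h0 : (u : ℝ) = 0
  · simp only [h0, if_true, mul_one, hexp hx]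
    field_simp
    simp
  by_cases h1 : (u : ℝ) = 1
  · simp only [h1, one_ne_zero, if_false, if_true]
    have := Real.integral_rpow_mul_exp_neg_mul_Ioi (a := 2) (r := x) (by norm_num) hx
    norm_num at this
    simp only [mul_comm (Real.exp _), neg_mul, this]
    rw [mul_one, add_sub_cancel]
    field_simp
  have hu0 : (0 : ℝ) < u := u.2.1.lt_of_ne' h0
  have hu1 : (0 : ℝ) < 1 - u := sub_pos.2 (u.2.2.lt_of_ne h1)
  have hs : 0 < (1 - u : ℝ) / u := by positivity
  have hd := harmonicKernel_denom_pos hx u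
  simp only [h0, h1, if_false]
  have e (t : ℝ) : Real.exp (-x * t) * ((1 - Real.exp (-((1 - u : ℝ) / u * t))) / (1 - u)) =
      (Real.exp (-x * t) - Real.exp (-(x + (1 - u : ℝ) / u) * t)) / (1 - u) := by
    rw [show -(x + (1 - u : ℝ) / u) * t = -x * t + -((1 - u : ℝ) / u * t) by ring, Real.exp_add]
    ring
  simp only [e]
  rw [integral_div, integral_sub (integrableOn_exp_mul_Ioi (by linarith) 0)
    (integrableOn_exp_mul_Ioi (by linarith) 0), hexp hx, hexp (by linarith)]
  have h3 : x + (1 - u : ℝ) / u = (1 + (x - 1) * u) / u := by field_simp; ring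
  rw [h3]
  field_simp
  ring

lemma integrableOn_exp_neg_mul_one_add {x : ℝ} (hx : 0 < x) :
    IntegrableOn (fun t : ℝ => Real.exp (-x * t) * (1 + t)) (Ioi 0) := by
  have h1 : IntegrableOn (fun t : ℝ => Real.exp (-x * t)) (Ioi 0) :=
    integrableOn_exp_mul_Ioi (by linarith) 0
  have h2 : IntegrableOn (fun t : ℝ => t * Real.exp (-x * t)) (Ioi 0) := by
    have := integrableOn_rpow_mul_exp_neg_mul_rpow (s := 1) (p := 1) (b := x) (by norm_num)
      one_pos hx
    simpa using this
  refine (h1.add h2).congr_fun (fun t _ => ?_) measurableSet_Ioi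
  simp only [Pi.add_apply]
  ring

lemma sq_mul_integral_exp_neg_mul_integral_bernsteinKernel {x : ℝ} (hx : 0 < x)
    (ν : Measure unitInterval) [IsFiniteMeasure ν] :
    x ^ 2 * ∫ t in Ioi (0 : ℝ), Real.exp (-x * t) * ∫ u, bernsteinKernel t u ∂ν =
      ∫ u, harmonicKernel x u ∂ν := by
  have h (t : ℝ) : Real.exp (-x * t) * ∫ u, bernsteinKernel t u ∂ν =
      ∫ u, Real.exp (-x * t) * bernsteinKernel t u ∂ν := (integral_const_mul _ _).symm
  simp only [h]
  rw [integral_integral_swap]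
  · simp only [integral_exp_neg_mul_bernsteinKernel hx]
    rw [integral_div]
    field_simp
  · refine ((integrableOn_exp_neg_mul_one_add hx).mul_prod (integrable_const (1 : ℝ))
      (ν := ν)).mono' ?_ ?_
    · exact ((by fun_prop : Measurable fun p : ℝ × unitInterval => Real.exp (-x * p.1)).mul
        measurable_bernsteinKernel).aestronglyMeasurable
    · filter_upwards [Measure.quasiMeasurePreserving_fst.ae (ae_restrict_mem measurableSet_Ioi)]
        with p hp
      have hp' : (0 : ℝ) ≤ p.1 := le_of_lt hp
      have := bernsteinKernel_nonneg hp' p.2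
      simp only [Function.uncurry]
      rw [Real.norm_of_nonneg (by positivity), mul_one]
      gcongr
      exact bernsteinKernel_le hp' p.2

lemma IsHarmonicMixture.isCBF {f : ℝ → ℝ} (hf : IsHarmonicMixture f) : IsCBF f := by
  obtain ⟨ν, hν⟩ := hf
  refine ⟨_, isBernstein_integral_bernsteinKernel (ν : Measure unitInterval), fun x hx => ?_⟩
  rw [hν x hx, sq_mul_integral_exp_neg_mul_integral_bernsteinKernel hx]

/-! ### Approximating Bernstein functions by mixtures -/

/-- `h` is, on `[0, ∞)`, a mixture of extremal Bernstein functions. -/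
def IsBernsteinMixture (h : ℝ → ℝ) : Prop :=
  ∃ ν : FiniteMeasure unitInterval, ∀ t : ℝ, 0 ≤ t →
    h t = ∫ u, bernsteinKernel t u ∂(ν : Measure unitInterval)

/-- The parameter `u` for which `bernsteinKernel · u` is proportional to `t ↦ 1 - e^{-st}`. -/
noncomputable def rateParam (s : ℝ) : unitInterval := projIcc 0 1 zero_le_one (1 + s)⁻¹

lemma one_sub_exp_eq_mul_bernsteinKernel {s : ℝ} (hs : 0 < s) (t : ℝ) :
    1 - Real.exp (-(s * t)) = s / (1 + s) * bernsteinKernel t (rateParam s) := by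
  have hu : ((rateParam s : unitInterval) : ℝ) = (1 + s)⁻¹ := by
    rw [rateParam, projIcc_of_mem _ ⟨by positivity, inv_le_one_of_one_le₀ (by linarith)⟩]
  have h1 : (1 + s)⁻¹ ≠ 1 := (inv_lt_one_of_one_lt₀ (by linarith)).ne
  have h0 : (1 + s)⁻¹ ≠ 0 := by positivity
  have e1 : 1 - (1 + s)⁻¹ = s / (1 + s) := by field_simp; ring
  have e2 : s / (1 + s) / (1 + s)⁻¹ = s := by field_simp
  simp only [bernsteinKernel, hu, h0, h1, if_false, e1, e2]
  field_simp

namespace IsBernsteinMixture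

lemma zero : IsBernsteinMixture fun _ => 0 := ⟨0, fun t _ => by simp⟩

lemma add {f g : ℝ → ℝ} (hf : IsBernsteinMixture f) (hg : IsBernsteinMixture g) :
    IsBernsteinMixture fun t => f t + g t := by
  obtain ⟨μ, hμ⟩ := hf
  obtain ⟨ν, hν⟩ := hg
  refine ⟨μ + ν, fun t ht => ?_⟩
  simp only [FiniteMeasure.toMeasure_add]
  rw [integral_add_measure (integrable_bernsteinKernel ht _) (integrable_bernsteinKernel ht _),
    hμ t ht, hν t ht]

lemma sum {ι : Type*} (s : Finset ι) {f : ι → ℝ → ℝ} (hf : ∀ i ∈ s, IsBernsteinMixture (f i)) :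
    IsBernsteinMixture fun t => ∑ i ∈ s, f i t := by
  classical
  induction s using Finset.induction_on with
  | empty => simpa using zero
  | insert a s ha ih =>
    simp only [Finset.sum_insert ha]
    exact (hf a (by simp)).add (ih fun i hi => hf i (by simp [hi]))

lemma const_mul_kernel {c : ℝ} (hc : 0 ≤ c) (u : unitInterval) :
    IsBernsteinMixture fun t => c * bernsteinKernel t u := by
  refine ⟨⟨c.toNNReal • Measure.dirac u, inferInstance⟩, fun t _ => ?_⟩
  change _ = ∫ v, bernsteinKernel t v ∂(c.toNNReal • Measure.dirac u)
  rw [integral_smul_nnreal_measure, NNReal.smul_def,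
    Real.coe_toNNReal c hc, smul_eq_mul]
  simp

lemma const {c : ℝ} (hc : 0 ≤ c) : IsBernsteinMixture fun _ => c := by
  simpa [bernsteinKernel] using const_mul_kernel hc 0

lemma const_mul_one_sub_exp {c s : ℝ} (hc : 0 ≤ c) (hs : 0 < s) :
    IsBernsteinMixture fun t => c * (1 - Real.exp (-(s * t))) := by
  simp only [one_sub_exp_eq_mul_bernsteinKernel hs, ← mul_assoc]
  exact const_mul_kernel (by positivity) _

lemma setIntegral_mul_kernel {w : ℝ → ℝ} {S : Set ℝ} (hS : MeasurableSet S)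
    (hw : IntegrableOn w S) (hw0 : ∀ v ∈ S, 0 ≤ w v) {φ : ℝ → unitInterval} (hφ : Measurable φ) :
    IsBernsteinMixture fun t => ∫ v in S, w v * bernsteinKernel t (φ v) := by
  set m : Measure ℝ := (volume.restrict S).withDensity fun v => ENNReal.ofReal (w v)
  have hm : IsFiniteMeasure m := isFiniteMeasure_withDensity_ofReal hw.2
  refine ⟨⟨m.map φ, inferInstance⟩, fun t _ => ?_⟩
  change _ = ∫ u, bernsteinKernel t u ∂(m.map φ)
  rw [integral_map hφ.aemeasurable (measurable_bernsteinKernel_right t).aestronglyMeasurable,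
    integral_withDensity_eq_integral_toReal_smul₀ hw.1.aemeasurable.ennreal_ofReal
      (ae_of_all _ fun _ => ENNReal.ofReal_lt_top)]
  refine setIntegral_congr_fun hS fun v hv => ?_
  simp only [ENNReal.toReal_ofReal (hw0 v hv), smul_eq_mul]

lemma setIntegral_mul_one_sub_exp {w s : ℝ → ℝ} {S : Set ℝ} (hS : MeasurableSet S)
    (hw : IntegrableOn w S) (hw0 : ∀ v ∈ S, 0 ≤ w v) (hs : Measurable s) (hs0 : ∀ v ∈ S, 0 < s v) :
    IsBernsteinMixture fun t => ∫ v in S, w v * (1 - Real.exp (-(s v * t))) := by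
  have hφ : Measurable fun v => rateParam (s v) :=
    continuous_projIcc.measurable.comp (measurable_const.add hs).inv
  have hw' : IntegrableOn (fun v => w v * (s v / (1 + s v))) S := by
    refine Integrable.mono hw (hw.1.mul
      (hs.div (measurable_const.add hs)).aestronglyMeasurable) ?_
    filter_upwards [ae_restrict_mem hS] with v hv
    have := hs0 v hv
    rw [norm_mul, Real.norm_of_nonneg (by positivity : 0 ≤ s v / (1 + s v))]
    exact mul_le_of_le_one_right (norm_nonneg _) ((div_le_one (by positivity)).2 (by linarith))
  obtain ⟨ν, hν⟩ := setIntegral_mul_kernel hS hw' (fun v hv => mul_nonneg (hw0 v hv)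
    (div_nonneg (hs0 v hv).le (by linarith [hs0 v hv]))) hφ
  refine ⟨ν, fun t ht => ?_⟩
  rw [← hν t ht]
  refine setIntegral_congr_fun hS fun v hv => ?_
  simp only [one_sub_exp_eq_mul_bernsteinKernel (hs0 v hv), mul_assoc]

end IsBernsteinMixture

lemma hasDerivAt_sum_taylor {D : ℕ → ℝ → ℝ} {u : ℝ}
    (hD : ∀ k, HasDerivAt (D k) (D (k + 1) u) u) (t : ℝ) (n : ℕ) :
    HasDerivAt (fun u => ∑ k ∈ Finset.range (n + 1), D k u * (t - u) ^ k / k.factorial)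
      (D (n + 1) u * (t - u) ^ n / n.factorial) u := by
  induction n with
  | zero => simpa using hD 0
  | succ n ih =>
    simp only [Finset.sum_range_succ _ (n + 1)]
    refine (ih.add (((hD (n + 1)).mul
      (((hasDerivAt_id' u).const_sub t).pow (n + 1))).div_const _)).congr_deriv ?_
    simp only [Pi.pow_apply, Nat.factorial_succ, Nat.add_sub_cancel]
    push_cast
    field_simp
    ring

lemma integral_deriv_mul_max_pow {D : ℕ → ℝ → ℝ}
    (hD : ∀ k u, 0 ≤ u → HasDerivAt (D k) (D (k + 1) u) u) {n : ℕ} (hn : n ≠ 0) {t T : ℝ}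
    (ht : 0 ≤ t) (htT : t ≤ T) :
    ∫ u in (0 : ℝ)..T, (-1) ^ n * D (n + 1) u * max 0 (u - t) ^ n / n.factorial =
      ∑ k ∈ Finset.range (n + 1), D k T * (t - T) ^ k / k.factorial - D 0 t := by
  have hc (a b : ℝ) (ha : 0 ≤ a) (hb : 0 ≤ b) : ContinuousOn (D (n + 1)) (uIcc a b) :=
    fun u hu => (hD (n + 1) u ((le_min ha hb).trans hu.1)).continuousAt.continuousWithinAt
  have hi (a b : ℝ) (ha : 0 ≤ a) (hb : 0 ≤ b) : IntervalIntegrable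
      (fun u => (-1) ^ n * D (n + 1) u * max 0 (u - t) ^ n / n.factorial) volume a b := by
    have := hc a b ha hb
    exact ContinuousOn.intervalIntegrable (by fun_prop)
  have hT := ht.trans htT
  rw [← intervalIntegral.integral_add_adjacent_intervals (hi 0 t le_rfl ht) (hi t T ht hT)]
  have h1 : ∫ u in (0 : ℝ)..t, (-1) ^ n * D (n + 1) u * max 0 (u - t) ^ n / n.factorial = 0 := by
    rw [intervalIntegral.integral_congr (g := fun _ => 0), intervalIntegral.integral_zero]
    intro u hu
    rw [uIcc_of_le ht] at hu
    simp only [max_eq_left (sub_nonpos.2 hu.2), zero_pow hn, mul_zero, zero_div]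
  have h2 : ∫ u in t..T, (-1) ^ n * D (n + 1) u * max 0 (u - t) ^ n / n.factorial =
      ∫ u in t..T, D (n + 1) u * (t - u) ^ n / n.factorial := by
    refine intervalIntegral.integral_congr fun u hu => ?_
    rw [uIcc_of_le htT] at hu
    simp only [max_eq_right (sub_nonneg.2 hu.1)]
    rw [← neg_sub u t, neg_pow (u - t)]
    ring
  have hct := hc t T ht hT
  rw [h1, h2, zero_add, intervalIntegral.integral_eq_sub_of_hasDerivAt
    (fun u hu => hasDerivAt_sum_taylor (fun k => hD k u ((le_min ht hT).trans hu.1)) t n)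
    (ContinuousOn.intervalIntegrable (by fun_prop))]
  congr 1
  rw [Finset.sum_eq_single_of_mem 0 (by simp) (fun k _ hk => by simp [hk])]
  simp

lemma eq_sum_add_integral_max_pow {D : ℕ → ℝ → ℝ}
    (hD : ∀ k u, 0 ≤ u → HasDerivAt (D k) (D (k + 1) u) u) {n : ℕ} (hn : n ≠ 0) {t T : ℝ}
    (ht : 0 ≤ t) (htT : t ≤ T) (hT : 0 < T) :
    D 0 t = D 0 0 + (∑ j ∈ Finset.range n, (-1) ^ j * D (j + 1) T * T ^ (j + 1) /
        (j + 1).factorial * (1 - max 0 (1 - t / T) ^ (j + 1)) +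
      ∫ u in Ioc 0 T, (-1) ^ n * D (n + 1) u * u ^ n / n.factorial *
        (1 - max 0 (1 - t / u) ^ n)) := by
  have e1 := integral_deriv_mul_max_pow hD hn ht htT
  have e2 := integral_deriv_mul_max_pow hD hn le_rfl hT.le
  have hc : ContinuousOn (D (n + 1)) (uIcc 0 T) := fun u hu =>
    (hD (n + 1) u ((le_min le_rfl hT.le).trans hu.1)).continuousAt.continuousWithinAt
  have hI : ∫ u in Ioc 0 T, (-1) ^ n * D (n + 1) u * u ^ n / n.factorial *
        (1 - max 0 (1 - t / u) ^ n) =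
      (∫ u in (0 : ℝ)..T, (-1) ^ n * D (n + 1) u * max 0 (u - 0) ^ n / n.factorial) -
      ∫ u in (0 : ℝ)..T, (-1) ^ n * D (n + 1) u * max 0 (u - t) ^ n / n.factorial := by
    rw [← intervalIntegral.integral_sub (ContinuousOn.intervalIntegrable (by fun_prop))
      (ContinuousOn.intervalIntegrable (by fun_prop)), intervalIntegral.integral_of_le hT.le]
    refine setIntegral_congr_fun measurableSet_Ioc fun u hu => ?_
    have hu0 : 0 < u := hu.1
    have h : max 0 (u - t) = u * max 0 (1 - t / u) := by
      rw [mul_max_of_nonneg _ _ hu0.le]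
      congr 1
      · simp
      · field_simp
    simp only [h, sub_zero, max_eq_right hu0.le, mul_pow]
    ring
  have hS : ∑ j ∈ Finset.range n, (-1) ^ j * D (j + 1) T * T ^ (j + 1) /
        (j + 1).factorial * (1 - max 0 (1 - t / T) ^ (j + 1)) =
      ∑ k ∈ Finset.range (n + 1), D k T * (t - T) ^ k / k.factorial -
      ∑ k ∈ Finset.range (n + 1), D k T * (0 - T) ^ k / k.factorial := by
    rw [← Finset.sum_sub_distrib, Finset.sum_range_succ']
    simp only [pow_zero, sub_self, add_zero]
    refine Finset.sum_congr rfl fun j _ => ?_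
    rw [max_eq_right (sub_nonneg.2 ((div_le_one hT).2 htT)),
      show t - T = -(T * (1 - t / T)) by field_simp; ring, zero_sub, neg_pow (T * _),
      neg_pow T, mul_pow]
    ring
  rw [hI, hS, e1, e2]
  ring

lemma max_pow_le_exp {v t : ℝ} (k : ℕ) : max 0 (1 - t / v) ^ k ≤ Real.exp (-(k / v * t)) := by
  have h : max 0 (1 - t / v) ≤ Real.exp (-(t / v)) :=
    max_le (Real.exp_pos _).le (by linarith [Real.add_one_le_exp (-(t / v))])
  calc max 0 (1 - t / v) ^ k ≤ Real.exp (-(t / v)) ^ k :=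
        pow_le_pow_left₀ (le_max_left _ _) h k
    _ = Real.exp (-(k / v * t)) := by rw [← Real.exp_nat_mul]; congr 1; ring

lemma exp_sub_max_pow_le {z : ℝ} (hz : 0 ≤ z) {k : ℕ} (hk : k ≠ 0) :
    Real.exp (-(k * z)) - max 0 (1 - z) ^ k ≤ Real.exp (-(k * z)) * (k * z ^ 2) := by
  have hk1 : (1 : ℝ) ≤ k := by exact_mod_cast Nat.one_le_iff_ne_zero.2 hk
  rcases le_total z 1 with h | h
  · have h1 : Real.exp (-z) * (1 - z ^ 2) ≤ 1 - z := by
      rw [Real.exp_neg, inv_mul_le_iff₀ (Real.exp_pos z)]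
      nlinarith [mul_le_mul_of_nonneg_right (Real.add_one_le_exp z) (sub_nonneg.2 h)]
    have h2 : 1 + k * -z ^ 2 ≤ (1 + -z ^ 2) ^ k := one_add_mul_le_pow (by nlinarith) k
    have h3 : Real.exp (-(k * z)) * (1 + k * -z ^ 2) ≤ (1 - z) ^ k := by
      calc Real.exp (-(k * z)) * (1 + k * -z ^ 2)
          ≤ Real.exp (-(k * z)) * (1 + -z ^ 2) ^ k := by gcongr
        _ = (Real.exp (-z) * (1 - z ^ 2)) ^ k := by
          rw [mul_pow, ← Real.exp_nat_mul, mul_neg, sub_eq_add_neg]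
        _ ≤ (1 - z) ^ k :=
          pow_le_pow_left₀ (mul_nonneg (Real.exp_pos _).le (by nlinarith)) h1 k
    rw [max_eq_right (sub_nonneg.2 h)]
    linarith
  · have h1 : 1 ≤ k * z ^ 2 := one_le_mul_of_one_le_of_one_le hk1 (one_le_pow₀ h)
    have h2 : 0 ≤ max 0 (1 - z) ^ k := pow_nonneg (le_max_left _ _) k
    nlinarith [Real.exp_pos (-(k * z))]

lemma exp_sub_max_pow_le_mul {k : ℕ} (hk : k ≠ 0) {v t ε : ℝ} (hv : 0 < v) (ht : 0 ≤ t)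
    (hε : Real.exp (-(k / v * t)) * (k / v * t ^ 2 * (1 + k / v)) ≤ k * ε) :
    Real.exp (-(k / v * t)) - max 0 (1 - t / v) ^ k ≤ ε * (1 - Real.exp (-(k / v))) := by
  have hk0 : (0 : ℝ) < k := by exact_mod_cast Nat.pos_of_ne_zero hk
  have hs : (0 : ℝ) < k / v := by positivity
  have hε0 : 0 ≤ ε := by
    have : 0 ≤ k * ε := le_trans (by positivity) hε
    exact nonneg_of_mul_nonneg_right this hk0
  have h := exp_sub_max_pow_le (div_nonneg ht hv.le) hk
  have e1 : (k : ℝ) * (t / v) = k / v * t := by ring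
  have e2 : (k : ℝ) * (t / v) ^ 2 = (k / v * t ^ 2 * (1 + k / v)) * (k / v / (1 + k / v) / k) := by
    field_simp
  have h2 : k / v / (1 + k / v) ≤ 1 - Real.exp (-(k / v)) := by
    have := Real.add_one_le_exp (k / v : ℝ)
    rw [Real.exp_neg, div_le_iff₀ (by positivity), sub_mul]
    have : (Real.exp (k / v))⁻¹ * (1 + k / v) ≤ 1 := by
      rw [inv_mul_le_iff₀ (Real.exp_pos _)]; linarith
    linarith
  rw [e1, e2, ← mul_assoc] at h
  calc _ ≤ _ := h
    _ ≤ k * ε * (k / v / (1 + k / v) / k) := by gcongr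
    _ = ε * (k / v / (1 + k / v)) := by field_simp
    _ ≤ _ := by gcongr

/-- A function with alternating derivatives on `[0, ∞)` is close to a mixture of extremal
Bernstein functions. -/
lemma exists_isBernsteinMixture_approx {D : ℕ → ℝ → ℝ}
    (hD : ∀ k u, 0 ≤ u → HasDerivAt (D k) (D (k + 1) u) u)
    (hpos : ∀ k u, 0 ≤ u → 0 ≤ (-1) ^ k * D (k + 1) u) (h0 : 0 ≤ D 0 0) {n : ℕ} (hn : n ≠ 0) :
    ∃ h, IsBernsteinMixture h ∧ ∀ t : ℝ, 0 ≤ t → t ≤ n →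
      h t ≤ D 0 t ∧ D 0 t - h t ≤ (t + 2 + 2 * t ^ 2) / n * h 1 := by
  have hn0 : (0 : ℝ) < n := by exact_mod_cast Nat.pos_of_ne_zero hn
  set b : ℕ → ℝ := fun j => (-1) ^ j * D (j + 1) n * (n : ℝ) ^ (j + 1) / (j + 1).factorial
  set w : ℝ → ℝ := fun u => (-1) ^ n * D (n + 1) u * u ^ n / n.factorial
  have hb (j : ℕ) : 0 ≤ b j := by
    have := hpos j n hn0.le
    positivity
  have hw0 : ∀ u ∈ Ioc (0 : ℝ) n, 0 ≤ w u := fun u hu => by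
    have := hpos n u hu.1.le
    have := hu.1
    positivity
  have hw : IntegrableOn w (Ioc 0 n) := by
    have hc : ContinuousOn (D (n + 1)) (Icc 0 n) := fun u hu =>
      (hD (n + 1) u hu.1).continuousAt.continuousWithinAt
    exact (ContinuousOn.integrableOn_Icc (by fun_prop)).mono_set Ioc_subset_Icc_self
  have hbdd {q : ℝ → ℝ} (hq : Measurable q) (hq0 : ∀ u ∈ Ioc (0 : ℝ) n, 0 ≤ q u ∧ q u ≤ 1) :
      IntegrableOn (fun u => w u * (1 - q u)) (Ioc 0 n) := by
    refine Integrable.mono hw (hw.1.mul (by fun_prop)) ?_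
    filter_upwards [ae_restrict_mem measurableSet_Ioc] with u hu
    obtain ⟨h1, h2⟩ := hq0 u hu
    rw [norm_mul, Real.norm_of_nonneg (by linarith : 0 ≤ 1 - q u)]
    exact mul_le_of_le_one_right (norm_nonneg _) (by linarith)
  have hexp {t : ℝ} (ht : 0 ≤ t) :
      IntegrableOn (fun u => w u * (1 - Real.exp (-(n / u * t)))) (Ioc 0 n) :=
    hbdd (by fun_prop) fun u hu => ⟨(Real.exp_pos _).le, by
      have := hu.1
      rw [Real.exp_le_one_iff, neg_nonpos]; positivity⟩
  have hmax {t : ℝ} (ht : 0 ≤ t) :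
      IntegrableOn (fun u => w u * (1 - max 0 (1 - t / u) ^ n)) (Ioc 0 n) :=
    hbdd (by fun_prop) fun u hu => ⟨pow_nonneg (le_max_left _ _) _,
      pow_le_one₀ (le_max_left _ _) (max_le zero_le_one (by
        have := div_nonneg ht hu.1.le
        linarith))⟩
  refine ⟨fun t => D 0 0 + (∑ j ∈ Finset.range n,
      b j * (1 - Real.exp (-(((j + 1 : ℕ) : ℝ) / n * t))) +
      ∫ u in Ioc 0 (n : ℝ), w u * (1 - Real.exp (-(n / u * t)))), ?_, fun t ht htn => ?_⟩
  · exact (IsBernsteinMixture.const h0).add ((IsBernsteinMixture.sum _ fun j _ =>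
      IsBernsteinMixture.const_mul_one_sub_exp (hb j) (by positivity)).add
      (IsBernsteinMixture.setIntegral_mul_one_sub_exp measurableSet_Ioc hw hw0 (by fun_prop)
        fun u hu => div_pos hn0 hu.1))
  · have hε0 : 0 ≤ (t + 2 + 2 * t ^ 2) / n := by positivity
    have hrep : D 0 t = D 0 0 +
        (∑ j ∈ Finset.range n, b j * (1 - max 0 (1 - t / n) ^ (j + 1)) +
        ∫ u in Ioc 0 (n : ℝ), w u * (1 - max 0 (1 - t / u) ^ n)) :=
      eq_sum_add_integral_max_pow hD hn ht htn hn0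
    beta_reduce
    rw [hrep]
    constructor
    · gcongr with j _ u hu
      · exact hb j
      · exact max_pow_le_exp _
      · exact hexp ht
      · exact hmax ht
      · exact measurableSet_Ioc.nullMeasurableSet
      · exact hw0 u hu
      · exact max_pow_le_exp _
    · have hS : ∑ j ∈ Finset.range n, b j * (1 - max 0 (1 - t / n) ^ (j + 1)) -
          ∑ j ∈ Finset.range n, b j * (1 - Real.exp (-(((j + 1 : ℕ) : ℝ) / n * t))) ≤
          (t + 2 + 2 * t ^ 2) / n *
            ∑ j ∈ Finset.range n, b j * (1 - Real.exp (-(((j + 1 : ℕ) : ℝ) / n * 1))) := by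
        rw [← Finset.sum_sub_distrib, Finset.mul_sum]
        refine Finset.sum_le_sum fun j hj => ?_
        have hjn : ((j + 1 : ℕ) : ℝ) / n ≤ 1 :=
          (div_le_one hn0).2 (by exact_mod_cast Finset.mem_range.1 hj)
        have := exp_sub_max_pow_le_mul (ε := (t + 2 + 2 * t ^ 2) / n) (Nat.add_one_ne_zero j) hn0 ht (by
          have e1 : Real.exp (-(((j + 1 : ℕ) : ℝ) / n * t)) ≤ 1 := by
            rw [Real.exp_le_one_iff, neg_nonpos]; positivity
          calc _ ≤ 1 * (((j + 1 : ℕ) : ℝ) / n * t ^ 2 * (1 + 1)) := by gcongr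
            _ = (j + 1 : ℕ) * ((2 * t ^ 2) / n) := by ring
            _ ≤ _ := by gcongr; linarith)
        rw [mul_one]
        linarith [mul_le_mul_of_nonneg_left this (hb j)]
      have hI : (∫ u in Ioc 0 (n : ℝ), w u * (1 - max 0 (1 - t / u) ^ n)) -
          ∫ u in Ioc 0 (n : ℝ), w u * (1 - Real.exp (-(n / u * t))) ≤
          (t + 2 + 2 * t ^ 2) / n *
            ∫ u in Ioc 0 (n : ℝ), w u * (1 - Real.exp (-(n / u * 1))) := by
        rw [← integral_sub (hmax ht) (hexp ht), ← integral_const_mul]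
        refine setIntegral_mono_on ((hmax ht).sub (hexp ht)) ((hexp zero_le_one).const_mul _)
          measurableSet_Ioc fun u hu => ?_
        have hu0 : 0 < u := hu.1
        have := exp_sub_max_pow_le_mul (ε := (t + 2 + 2 * t ^ 2) / n) hn hu0 ht (by
          have e1 := pow_mul_exp_neg_le one_pos (by positivity : 0 ≤ n / u * t) 1
          have e2 := pow_mul_exp_neg_le one_pos (by positivity : 0 ≤ n / u * t) 2
          rw [mul_one, one_pow, div_one] at e1 e2
          norm_num [Nat.factorial] at e1 e2
          rw [mul_div_cancel₀ _ hn0.ne']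
          nlinarith [mul_le_mul_of_nonneg_left e1 ht])
        rw [mul_one]
        linarith [mul_le_mul_of_nonneg_left this (hw0 u hu)]
      have := mul_nonneg hε0 h0
      rw [mul_add, mul_add]
      linarith

lemma one_le_bernsteinKernel_one (u : unitInterval) : 1 ≤ bernsteinKernel 1 u := by
  have h0 := u.2.1
  have h1 := u.2.2
  unfold bernsteinKernel
  split_ifs with hu0 hu1
  · exact le_rfl
  · exact le_rfl
  · have h1' : (0 : ℝ) < 1 - u := sub_pos.2 (h1.lt_of_ne hu1)
    have h0' : (0 : ℝ) < u := h0.lt_of_ne' hu0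
    have h2 : (u : ℝ)⁻¹ ≤ Real.exp ((1 - u) / u) := by
      have := Real.add_one_le_exp ((1 - u : ℝ) / u)
      rwa [show (1 - u : ℝ) / u + 1 = (u : ℝ)⁻¹ by field_simp; ring] at this
    rw [le_div_iff₀ h1', mul_one, Real.exp_neg]
    linarith [inv_le_of_inv_le₀ h0' h2]

lemma integral_bernsteinKernel_le {t : ℝ} (ht : 0 ≤ t) (ν : Measure unitInterval)
    [IsFiniteMeasure ν] :
    ∫ u, bernsteinKernel t u ∂ν ≤ (1 + t) * ∫ u, bernsteinKernel 1 u ∂ν := by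
  rw [← integral_const_mul]
  refine integral_mono (integrable_bernsteinKernel ht ν)
    ((integrable_bernsteinKernel zero_le_one ν).const_mul _) fun u => ?_
  exact (bernsteinKernel_le ht u).trans
    (le_mul_of_one_le_right (by linarith) (one_le_bernsteinKernel_one u))

/-- A Bernstein function is a pointwise limit on `(0, ∞)` of mixtures of extremal Bernstein
functions of bounded mass. -/
lemma IsBernstein.exists_tendsto_mixture {g : ℝ → ℝ} (hg : IsBernstein g) :
    ∃ (C : ℝ) (h : ℕ → ℝ → ℝ), (∀ n, IsBernsteinMixture (h n)) ∧ (∀ n, h n 1 ≤ C) ∧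
      ∀ t, 0 < t → Tendsto (fun n => h n t) atTop (nhds (g t)) := by
  obtain ⟨hg0, hgc, hgs, hgd⟩ := hg
  have hderiv (k : ℕ) {t : ℝ} (ht : 0 < t) : HasDerivAt (iteratedDerivWithin k g (Ioi 0))
      (iteratedDerivWithin (k + 1) g (Ioi 0) t) t := by
    have hd := hgs.differentiableOn_iteratedDerivWithin (m := k)
      (by exact_mod_cast WithTop.coe_lt_top _) (uniqueDiffOn_Ioi 0)
    rw [iteratedDerivWithin_succ]
    exact (hd t ht).hasDerivWithinAt.hasDerivAt (Ioi_mem_nhds ht)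
  have happ (n : ℕ) : ∃ h, IsBernsteinMixture h ∧ ∀ t : ℝ, 0 ≤ t → t ≤ (n + 1 : ℕ) →
      h t ≤ g (t + 1 / (n + 1 : ℕ)) ∧
      g (t + 1 / (n + 1 : ℕ)) - h t ≤ (t + 2 + 2 * t ^ 2) / (n + 1 : ℕ) * h 1 := by
    have hδ : (0 : ℝ) < 1 / (n + 1 : ℕ) := by positivity
    simpa only [iteratedDerivWithin_zero] using exists_isBernsteinMixture_approx
      (D := fun k t => iteratedDerivWithin k g (Ioi 0) (t + 1 / (n + 1 : ℕ)))
      (fun k u hu => (hderiv k (by linarith)).comp_add_const _ _)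
      (fun k u hu => hgd (k + 1) (by omega) _ (by linarith))
      (by simpa using hg0 _ (by positivity)) n.succ_ne_zero
  choose h hmix happrox using happ
  have hmono : MonotoneOn g (Ioi 0) := by
    refine monotoneOn_of_deriv_nonneg (convex_Ioi 0) (hgc.mono Ioi_subset_Ici_self) ?_ ?_
    · rw [interior_Ioi]
      exact fun t ht => (hderiv 0 ht).differentiableAt.differentiableWithinAt
    · rw [interior_Ioi]
      intro t ht
      have h1 := hderiv 0 ht
      rw [iteratedDerivWithin_zero] at h1
      rw [h1.deriv]
      simpa using hgd 1 le_rfl t ht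
  have hone (n : ℕ) : h n 1 ≤ g 2 := by
    have h1 : 1 / ((n + 1 : ℕ) : ℝ) ≤ 1 := by
      rw [div_le_one (by positivity)]; exact_mod_cast Nat.le_add_left 1 n
    have h2 : (0 : ℝ) < 1 / ((n + 1 : ℕ) : ℝ) := by positivity
    exact ((happrox n 1 zero_le_one (by exact_mod_cast Nat.le_add_left 1 n)).1).trans
      (hmono (show (0 : ℝ) < _ by linarith) (show (0 : ℝ) < 2 by norm_num) (by linarith))
  refine ⟨g 2, h, hmix, hone, fun t ht => ?_⟩
  have hlim : Tendsto (fun n : ℕ => 1 / ((n + 1 : ℕ) : ℝ)) atTop (nhds 0) := by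
    simpa using tendsto_one_div_add_atTop_nhds_zero_nat (𝕜 := ℝ)
  have hgt : Tendsto (fun n : ℕ => g (t + 1 / ((n + 1 : ℕ) : ℝ))) atTop (nhds (g t)) := by
    have hc : ContinuousAt g t := hgc.continuousAt (Ici_mem_nhds ht)
    refine hc.tendsto.comp ?_
    simpa using hlim.const_add t
  have hlow : Tendsto (fun n : ℕ => g (t + 1 / ((n + 1 : ℕ) : ℝ)) -
      (t + 2 + 2 * t ^ 2) * g 2 * (1 / ((n + 1 : ℕ) : ℝ))) atTop (nhds (g t)) := by
    simpa using hgt.sub (hlim.const_mul ((t + 2 + 2 * t ^ 2) * g 2))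
  have hev : ∀ᶠ n : ℕ in atTop, t ≤ (n + 1 : ℕ) := by
    filter_upwards [eventually_ge_atTop ⌈t⌉₊] with n hn
    exact (Nat.le_ceil t).trans (by exact_mod_cast hn.trans n.le_succ)
  refine tendsto_of_tendsto_of_tendsto_of_le_of_le' hlow hgt ?_ ?_
  · filter_upwards [hev] with n hn
    have h1 := (happrox n t ht.le hn).2
    have h2 : (t + 2 + 2 * t ^ 2) / (n + 1 : ℕ) * h n 1 ≤
        (t + 2 + 2 * t ^ 2) / (n + 1 : ℕ) * g 2 :=
      mul_le_mul_of_nonneg_left (hone n) (by positivity)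
    have h3 : (t + 2 + 2 * t ^ 2) * g 2 * (1 / ((n + 1 : ℕ) : ℝ)) =
        (t + 2 + 2 * t ^ 2) / (n + 1 : ℕ) * g 2 := by ring
    linarith
  · filter_upwards [hev] with n hn
    exact (happrox n t ht.le hn).1

lemma IsCBF.isHarmonicMixture {f : ℝ → ℝ} (hf : IsCBF f) : IsHarmonicMixture f := by
  obtain ⟨g, hg, hfg⟩ := hf
  obtain ⟨C, h, hmix, hC, hlim⟩ := hg.exists_tendsto_mixture
  choose ν hν using hmix
  refine IsHarmonicMixture.of_tendsto
    (F := fun n x => ∫ u, harmonicKernel x u ∂(ν n : Measure unitInterval))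
    (fun n => ⟨ν n, fun x _ => rfl⟩) fun x hx => ?_
  rw [hfg x hx]
  simp only [← sq_mul_integral_exp_neg_mul_integral_bernsteinKernel hx]
  refine Tendsto.const_mul _ (tendsto_integral_of_dominated_convergence
    (fun t => Real.exp (-x * t) * (1 + t) * C) (fun n => ?_)
    ((integrableOn_exp_neg_mul_one_add hx).mul_const C) (fun n => ?_) ?_)
  · exact ((by fun_prop : Measurable fun t : ℝ => Real.exp (-x * t)).aestronglyMeasurable).mul
      (measurable_bernsteinKernel.aestronglyMeasurable.integral_prod_right')
  · filter_upwards [ae_restrict_mem measurableSet_Ioi] with t ht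
    have ht0 : (0 : ℝ) ≤ t := le_of_lt ht
    rw [norm_mul, Real.norm_of_nonneg (Real.exp_pos _).le, mul_assoc, Real.norm_of_nonneg
      (integral_nonneg fun u => bernsteinKernel_nonneg ht0 u)]
    have h1 := hC n
    rw [hν n 1 zero_le_one] at h1
    exact mul_le_mul_of_nonneg_left ((integral_bernsteinKernel_le ht0 _).trans
      (mul_le_mul_of_nonneg_left h1 (by linarith))) (Real.exp_pos _).le
  · filter_upwards [ae_restrict_mem measurableSet_Ioi] with t ht
    simp only [← hν _ t (le_of_lt ht)]
    exact (hlim t ht).const_mul _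

/-- log-convexity of the CBF class: if `f, g` are complete Bernstein
functions and `0 ≤ α ≤ 1`, then `p ↦ f(p)^α g(p)^{1-α}` is a complete Bernstein
function (real powers, with `0^0 = 1` and `0^β = 0` for `β > 0`). -/
theorem cbf_pow_mul_pow (f g : ℝ → ℝ) (hf : IsCBF f) (hg : IsCBF g)
    (α : ℝ) (hα0 : 0 ≤ α) (hα1 : α ≤ 1) :
    IsCBF (fun p => f p ^ α * g p ^ (1 - α)) := by
  rcases hα0.eq_or_lt with rfl | h0
  · simpa using hg
  rcases hα1.eq_or_lt with rfl | h1
  · simpa using hf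
  exact (hf.isHarmonicMixture.rpow_mul_rpow hg.isHarmonicMixture h0 h1).isCBF
end

section
/- A function f : (0,∞) → ℝ is completely monotone and integrable on (0,1) if and only if there exists a (positive) measure μ on [0,∞) such that ∫_{[0,∞)} 1/(1+r) dμ(r) < ∞ and f(t) = ∫_{[0,∞)} e^{−t r} dμ(r) for all t > 0. -/
open MeasureTheory Set Filter

/-- Completely monotone on `(0,∞)`: infinitely differentiable with
`(-1)ⁿ f⁽ⁿ⁾(x) ≥ 0` for all `x > 0` and all integers `n ≥ 0`. -/
def IsCM (f : ℝ → ℝ) : Prop :=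
  ContDiffOn ℝ (⊤ : ℕ∞) f (Set.Ioi 0) ∧
  ∀ n : ℕ, ∀ x : ℝ, 0 < x →
    0 ≤ (-1 : ℝ) ^ n * iteratedDerivWithin n f (Set.Ioi 0) x

lemma half_div_le_integral_one_sub_div_pow {T : ℝ} (hT : 1 ≤ T) (k : ℕ) :
    1 / 2 * (1 / (1 + k / T)) ≤ ∫ t in (0 : ℝ)..1, (1 - t / T) ^ k := by
  have hT0 : 0 < T := by linarith
  have hint : ∫ t in (0 : ℝ)..1, (1 - t / T) ^ k =
      T / (k + 1) * (1 - (1 - 1 / T) ^ (k + 1)) := by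
    have hd : ∀ t ∈ uIcc (0 : ℝ) 1, HasDerivAt
        (fun t : ℝ => -(T / (k + 1)) * (1 - t / T) ^ (k + 1)) ((1 - t / T) ^ k) t := by
      intro t _
      have h1 : HasDerivAt (fun t : ℝ => 1 - t / T) (-(1 / T)) t := by
        simpa using ((hasDerivAt_id t).div_const T).const_sub 1
      convert! (h1.pow (k + 1)).const_mul (-(T / (k + 1))) using 1
      have : (k : ℝ) + 1 ≠ 0 := by positivity
      push_cast
      field_simp
    rw [intervalIntegral.integral_eq_sub_of_hasDerivAt hd (by
      apply Continuous.intervalIntegrable; fun_prop)]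
    simp
    ring
  have hy : 0 < ((k : ℝ) + 1) / T := by positivity
  set y := ((k : ℝ) + 1) / T with hydef
  have h1 : (1 - 1 / T) ^ (k + 1) ≤ Real.exp (-y) := by
    have h2 : 1 - 1 / T ≤ Real.exp (-(1 / T)) := Real.one_sub_le_exp_neg _
    have h3 : 0 ≤ 1 - 1 / T := by rw [sub_nonneg, div_le_one hT0]; exact hT
    calc (1 - 1 / T) ^ (k + 1) ≤ Real.exp (-(1 / T)) ^ (k + 1) := by gcongr
      _ = Real.exp (-y) := by
        rw [← Real.exp_nat_mul]; congr 1; rw [hydef]; push_cast; ring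
  have h4 : Real.exp (-y) ≤ 1 / (1 + y) := by
    rw [Real.exp_neg, one_div]
    exact inv_anti₀ (by positivity) (by linarith [Real.add_one_le_exp y])
  have h5 : T / (k + 1) = 1 / y := by rw [hydef]; simp
  rw [hint, h5]
  have h6 : 1 / y * (1 - 1 / (1 + y)) ≤ 1 / y * (1 - (1 - 1 / T) ^ (k + 1)) := by
    gcongr; linarith
  refine le_trans ?_ h6
  have h7 : 1 / y * (1 - 1 / (1 + y)) = 1 / (1 + y) := by field_simp; ring
  have h8 : y ≤ 1 + k / T := by
    have : 1 / T ≤ 1 := (div_le_one hT0).2 hT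
    rw [hydef, add_div]; linarith
  have h9 : 0 ≤ (k : ℝ) / T := by positivity
  rw [h7, one_div_mul_one_div]
  exact one_div_le_one_div_of_le (by positivity) (by linarith)

lemma abs_one_sub_pow_sub_exp_le {T t : ℝ} (ht : 0 < t) (htT : t < T) (k : ℕ) :
    (1 + k / T) * |(1 - t / T) ^ k - Real.exp (-t * (k / T))| ≤ (t + 2) / T := by
  have hT := ht.trans htT
  set a := t / T with ha
  have ha0 : 0 < a := div_pos ht hT
  have ha1 : a < 1 := (div_lt_one hT).2 htT
  set y := t * (k / T) with hy
  have hy0 : 0 ≤ y := by positivity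
  have hya : y = k * a := by rw [hy, ha]; ring
  have hexp : Real.exp (-a) ^ k = Real.exp (-y) := by
    rw [← Real.exp_nat_mul, hya]; congr 1; ring
  have hup : (1 - a) ^ k ≤ Real.exp (-y) := by
    rw [← hexp]
    have := Real.one_sub_le_exp_neg a
    have : 0 ≤ 1 - a := by linarith
    gcongr
  have hlow : Real.exp (-y) * (1 - k * a ^ 2) ≤ (1 - a) ^ k := by
    have h1 : Real.exp (-a) * (1 - a ^ 2) ≤ 1 - a := by
      have h2 : Real.exp (-a) * (1 + a) ≤ 1 := by
        rw [Real.exp_neg, inv_mul_le_one₀ (Real.exp_pos a)]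
        linarith [Real.add_one_le_exp a]
      nlinarith [Real.exp_pos (-a)]
    have h3 : 0 ≤ 1 - a ^ 2 := by nlinarith
    calc Real.exp (-y) * (1 - k * a ^ 2) ≤ Real.exp (-a) ^ k * (1 - a ^ 2) ^ k := by
          rw [hexp]
          gcongr
          have := one_add_mul_le_pow (a := -a ^ 2) (by nlinarith) k
          calc _ = 1 + k * (-a ^ 2) := by ring
            _ ≤ _ := this
            _ = _ := by ring
      _ = (Real.exp (-a) * (1 - a ^ 2)) ^ k := (mul_pow _ _ _).symm
      _ ≤ _ := by gcongr
  have habs : |(1 - a) ^ k - Real.exp (-t * (k / T))| ≤ a * (y * Real.exp (-y)) := by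
    rw [neg_mul, ← hy, abs_sub_comm, abs_of_nonneg (by linarith)]
    calc _ ≤ Real.exp (-y) * (k * a ^ 2) := by linarith
      _ = _ := by rw [hya]; ring
  have hy1 : y * Real.exp (-y) ≤ 1 := by
    rw [Real.exp_neg, ← div_eq_mul_inv, div_le_one (Real.exp_pos y)]
    linarith [Real.add_one_le_exp y]
  have hy2 : y ^ 2 * Real.exp (-y) ≤ 2 := by
    rw [Real.exp_neg, ← div_eq_mul_inv, div_le_iff₀ (Real.exp_pos y)]
    nlinarith [Real.quadratic_le_exp_of_nonneg hy0]
  calc (1 + k / T) * |(1 - a) ^ k - Real.exp (-t * (k / T))|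
      ≤ (1 + k / T) * (a * (y * Real.exp (-y))) := by gcongr
    _ = (t * (y * Real.exp (-y)) + y ^ 2 * Real.exp (-y)) / T := by
        rw [ha, hy]; ring
    _ ≤ (t + 2) / T := by
        gcongr
        nlinarith

/-- The point `exp (-r)` of the unit interval. -/
noncomputable def expNegPoint (r : ℝ) : unitInterval :=
  ⟨Real.exp (-|r|), (Real.exp_pos _).le, Real.exp_le_one_iff.2 (by simp)⟩

/-- The continuous extension to the unit interval of the function `x ↦ x ^ t * (1 - log x)`, which
at `x = exp (-r)` takes the value `(1 + r) * exp (-t * r)`. -/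
noncomputable def expKernel (t : ℝ) (ht : 0 < t) : BoundedContinuousFunction unitInterval ℝ :=
  BoundedContinuousFunction.mkOfCompact
    ⟨fun x => (x : ℝ) ^ t - (x : ℝ) ^ t * Real.log ((x : ℝ) ^ t) / t, by
      have h : Continuous fun x : unitInterval => (x : ℝ) ^ t :=
        (Real.continuous_rpow_const ht.le).comp continuous_subtype_val
      exact h.sub ((Real.continuous_mul_log.comp h).div_const t)⟩

lemma expKernel_apply {t : ℝ} (ht : 0 < t) (x : unitInterval) :
    expKernel t ht x = (x : ℝ) ^ t - (x : ℝ) ^ t * Real.log ((x : ℝ) ^ t) / t := rfl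

lemma expKernel_of_pos {t : ℝ} (ht : 0 < t) {x : unitInterval} (hx : 0 < (x : ℝ)) :
    expKernel t ht x = (1 + -Real.log x) * Real.exp (-t * -Real.log x) := by
  rw [expKernel_apply, Real.log_rpow hx, Real.rpow_def_of_pos hx]
  rw [show -t * -Real.log x = Real.log x * t by ring]
  field_simp
  ring

lemma expKernel_of_eq_zero {t : ℝ} (ht : 0 < t) {x : unitInterval} (hx : (x : ℝ) = 0) :
    expKernel t ht x = 0 := by
  simp [expKernel_apply, hx, Real.zero_rpow ht.ne']

lemma expKernel_expNegPoint {t r : ℝ} (ht : 0 < t) (hr : 0 ≤ r) :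
    expKernel t ht (expNegPoint r) = (1 + r) * Real.exp (-t * r) := by
  rw [expKernel_of_pos ht (Real.exp_pos _)]
  simp [expNegPoint, abs_of_nonneg hr]

namespace IsCM

variable {f : ℝ → ℝ}

lemma contDiffAt (hf : IsCM f) {x : ℝ} (hx : 0 < x) : ContDiffAt ℝ (⊤ : ℕ∞) f x :=
  hf.1.contDiffAt (Ioi_mem_nhds hx)

lemma neg_one_pow_mul_iteratedDeriv_nonneg (hf : IsCM f) (n : ℕ) {x : ℝ} (hx : 0 < x) :
    0 ≤ (-1 : ℝ) ^ n * iteratedDeriv n f x := by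
  rw [← iteratedDerivWithin_of_isOpen isOpen_Ioi (mem_Ioi.2 hx)]
  exact hf.2 n x hx

/-- The coefficient of `(1 - t / T) ^ k` in the Taylor expansion of `f t` about `T`. -/
noncomputable def taylorWeight (f : ℝ → ℝ) (T : ℝ) (k : ℕ) : ℝ :=
  (-1 : ℝ) ^ k * iteratedDeriv k f T * T ^ k / k.factorial

lemma taylorWeight_nonneg (hf : IsCM f) {T : ℝ} (hT : 0 < T) (k : ℕ) :
    0 ≤ taylorWeight f T k := by
  have := hf.neg_one_pow_mul_iteratedDeriv_nonneg k hT
  unfold taylorWeight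
  positivity

/-- The integral remainder of the Taylor expansion of `f t` about `T > t`. -/
noncomputable def taylorRemainder (f : ℝ → ℝ) (T t : ℝ) (n : ℕ) : ℝ :=
  ∫ s in t..T, (s - t) ^ n / n.factorial * ((-1 : ℝ) ^ (n + 1) * iteratedDeriv (n + 1) f s)

lemma continuousOn_iteratedDeriv (hf : IsCM f) (n : ℕ) :
    ContinuousOn (iteratedDeriv n f) (Ioi 0) := by
  have := hf.1.continuousOn_iteratedDerivWithin (m := n) (by exact_mod_cast le_top)
    (uniqueDiffOn_Ioi 0)
  exact this.congr fun x hx => (iteratedDerivWithin_of_isOpen isOpen_Ioi hx).symm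

lemma eq_sum_add_taylorRemainder (hf : IsCM f) {T t : ℝ} (ht : 0 < t) (htT : t < T) (n : ℕ) :
    f t = ∑ k ∈ Finset.range (n + 1), taylorWeight f T k * (1 - t / T) ^ k +
      taylorRemainder f T t n := by
  have hT : 0 < T := ht.trans htT
  have hsub : uIcc T t ⊆ Ioi 0 := by
    rw [uIcc_of_ge htT.le]
    exact fun x hx => ht.trans_le hx.1
  have hud : UniqueDiffOn ℝ (uIcc T t) := uniqueDiffOn_uIcc htT.ne'
  have hder : ∀ k : ℕ, ∀ x ∈ uIcc T t,
      iteratedDerivWithin k f (uIcc T t) x = iteratedDeriv k f x := fun k x hx =>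
    iteratedDerivWithin_eq_iteratedDeriv hud
      ((hf.contDiffAt (hsub hx)).of_le (by exact_mod_cast le_top)) hx
  have key := taylor_integral_remainder (f := f) (x := t) (x₀ := T) (n := n)
    ((hf.1.mono hsub).of_le (by exact_mod_cast le_top))
  rw [taylor_within_apply] at key
  have h1 : ∀ k, ((k.factorial : ℝ)⁻¹ * (t - T) ^ k) • iteratedDerivWithin k f (uIcc T t) T =
      taylorWeight f T k * (1 - t / T) ^ k := by
    intro k
    have : (1 - t / T) = (-1) * (t - T) / T := by field_simp; ring
    rw [hder k T left_mem_uIcc, taylorWeight, this, div_pow, mul_pow, smul_eq_mul]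
    have h2 : ((-1 : ℝ) ^ k) * (-1) ^ k = 1 := by rw [← mul_pow]; simp
    field_simp
    linear_combination (-(t - T) ^ k * iteratedDeriv k f T) * h2
  rw [Finset.sum_congr rfl fun k _ => h1 k] at key
  have h3 : (∫ s in T..t, ((t - s) ^ n / (n.factorial : ℝ)) •
      iteratedDerivWithin (n + 1) f (uIcc T t) s) = taylorRemainder f T t n := by
    rw [intervalIntegral.integral_symm, taylorRemainder, ← intervalIntegral.integral_neg]
    refine intervalIntegral.integral_congr fun s hs => ?_
    rw [uIcc_comm] at hs
    simp only [hder _ s hs, smul_eq_mul]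
    rw [show t - s = (-1) * (s - t) by ring, mul_pow]
    ring
  rw [h3] at key
  linarith

lemma taylorRemainder_integrand_nonneg (hf : IsCM f) {t s : ℝ} (ht : 0 < t) (hs : t ≤ s) (n : ℕ) :
    0 ≤ (s - t) ^ n / n.factorial * ((-1 : ℝ) ^ (n + 1) * iteratedDeriv (n + 1) f s) := by
  have h1 := hf.neg_one_pow_mul_iteratedDeriv_nonneg (n + 1) (ht.trans_le hs)
  have h2 : 0 ≤ s - t := sub_nonneg.2 hs
  positivity

lemma taylorRemainder_nonneg (hf : IsCM f) {T t : ℝ} (ht : 0 < t) (htT : t ≤ T) (n : ℕ) :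
    0 ≤ taylorRemainder f T t n :=
  intervalIntegral.integral_nonneg htT fun _ hs => hf.taylorRemainder_integrand_nonneg ht hs.1 n

lemma taylorRemainder_intervalIntegrable (hf : IsCM f) {t a b : ℝ} (ha : 0 < a) (hab : a ≤ b)
    (n : ℕ) : IntervalIntegrable (fun s => (s - t) ^ n / n.factorial *
      ((-1 : ℝ) ^ (n + 1) * iteratedDeriv (n + 1) f s)) volume a b := by
  apply ContinuousOn.intervalIntegrable
  have : ContinuousOn (iteratedDeriv (n + 1) f) (uIcc a b) :=
    (hf.continuousOn_iteratedDeriv (n + 1)).mono fun x hx => by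
      rw [uIcc_of_le hab] at hx
      exact ha.trans_le hx.1
  fun_prop

lemma sum_taylorWeight_le (hf : IsCM f) {T t : ℝ} (ht : 0 < t) (htT : t < T) (n : ℕ) :
    ∑ k ∈ Finset.range n, taylorWeight f T k * (1 - t / T) ^ k ≤ f t := by
  have h0 : 0 ≤ 1 - t / T := by
    rw [sub_nonneg, div_le_one (ht.trans htT)]; exact htT.le
  rw [hf.eq_sum_add_taylorRemainder ht htT n, Finset.sum_range_succ]
  have := hf.taylorRemainder_nonneg ht htT.le n
  have := mul_nonneg (hf.taylorWeight_nonneg (ht.trans htT) n) (pow_nonneg h0 n)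
  linarith

lemma taylorRemainder_le (hf : IsCM f) {T t u : ℝ} (hu : 0 < u) (hut : u < t) (htT : t < T)
    (n : ℕ) : taylorRemainder f T t n ≤ ((T - t) / (T - u)) ^ n * taylorRemainder f T u n := by
  have ht := hu.trans hut
  have hTu : 0 < T - u := by linarith
  have hi : ∀ v, IntervalIntegrable (fun s => (s - v) ^ n / n.factorial *
      ((-1 : ℝ) ^ (n + 1) * iteratedDeriv (n + 1) f s)) volume t T := fun v =>
    hf.taylorRemainder_intervalIntegrable ht htT.le n
  have hq : 0 ≤ ((T - t) / (T - u)) ^ n :=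
    pow_nonneg (div_nonneg (by linarith) hTu.le) n
  calc taylorRemainder f T t n
      ≤ ∫ s in t..T, ((T - t) / (T - u)) ^ n * ((s - u) ^ n / n.factorial *
          ((-1 : ℝ) ^ (n + 1) * iteratedDeriv (n + 1) f s)) := by
        refine intervalIntegral.integral_mono_on htT.le (hi t) ((hi u).const_mul _) fun s hs => ?_
        have h1 := hf.neg_one_pow_mul_iteratedDeriv_nonneg (n + 1) (ht.trans_le hs.1)
        rw [← mul_assoc (((T - t) / (T - u)) ^ n), mul_div_assoc', ← mul_pow]
        have : 0 ≤ s - t := sub_nonneg.2 hs.1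
        gcongr
        rw [div_mul_eq_mul_div, le_div_iff₀ hTu]
        nlinarith [hs.1, hs.2]
    _ = ((T - t) / (T - u)) ^ n * ∫ s in t..T, (s - u) ^ n / n.factorial *
          ((-1 : ℝ) ^ (n + 1) * iteratedDeriv (n + 1) f s) :=
        intervalIntegral.integral_const_mul _ _
    _ ≤ _ := by
        refine mul_le_mul_of_nonneg_left ?_ hq
        rw [taylorRemainder, ← intervalIntegral.integral_add_adjacent_intervals
          (hf.taylorRemainder_intervalIntegrable hu hut.le n) (hi u)]
        have := intervalIntegral.integral_nonneg (μ := volume) hut.le fun s hs =>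
          hf.taylorRemainder_integrand_nonneg hu hs.1 n
        linarith

/-- A completely monotone function is the sum of its Taylor series about `T` on `(0, T)`. -/
theorem hasSum_taylorWeight (hf : IsCM f) {T t : ℝ} (ht : 0 < t) (htT : t < T) :
    HasSum (fun k => taylorWeight f T k * (1 - t / T) ^ k) (f t) := by
  have hT := ht.trans htT
  have h0 : 0 ≤ 1 - t / T := by
    rw [sub_nonneg, div_le_one hT]; exact htT.le
  rw [hasSum_iff_tendsto_nat_of_nonneg fun k =>
    mul_nonneg (hf.taylorWeight_nonneg hT k) (pow_nonneg h0 k), ← tendsto_add_atTop_iff_nat 1]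
  have hden : 0 < T - t / 2 := by linarith
  have hlim : Tendsto (fun n => taylorRemainder f T t n) atTop (nhds 0) := by
    have hq : Tendsto (fun n : ℕ => ((T - t) / (T - t / 2)) ^ n * f (t / 2)) atTop (nhds 0) := by
      rw [← zero_mul (f (t / 2))]
      refine (tendsto_pow_atTop_nhds_zero_of_lt_one
        (div_nonneg (by linarith) hden.le) ?_).mul_const _
      rw [div_lt_one hden]; linarith
    refine squeeze_zero (fun n => hf.taylorRemainder_nonneg ht htT.le n) (fun n => ?_) hq
    refine (hf.taylorRemainder_le (half_pos ht) (half_lt_self ht) htT n).trans ?_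
    refine mul_le_mul_of_nonneg_left ?_
      (pow_nonneg (div_nonneg (by linarith) hden.le) n)
    have h1 := hf.eq_sum_add_taylorRemainder (T := T) (half_pos ht) (by linarith) n
    have h2 : 0 ≤ 1 - t / 2 / T := by
      rw [sub_nonneg, div_le_one hT]; linarith
    have h3 : 0 ≤ ∑ k ∈ Finset.range (n + 1), taylorWeight f T k * (1 - t / 2 / T) ^ k :=
      Finset.sum_nonneg fun k _ => mul_nonneg (hf.taylorWeight_nonneg hT k) (pow_nonneg h2 k)
    linarith
  have h4 := (tendsto_const_nhds (x := f t)).sub hlim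
  rw [sub_zero] at h4
  refine h4.congr fun n => ?_
  linarith [hf.eq_sum_add_taylorRemainder ht htT n]

/-- The `k`-th Taylor weight about `T`, normalised so that the total mass is controlled by the
integral of `f` over `(0, 1)`. -/
noncomputable def normalizedWeight (f : ℝ → ℝ) (T : ℝ) (k : ℕ) : ℝ :=
  taylorWeight f T k * (1 / (1 + k / T))

lemma normalizedWeight_nonneg (hf : IsCM f) {T : ℝ} (hT : 0 < T) (k : ℕ) :
    0 ≤ normalizedWeight f T k :=
  mul_nonneg (hf.taylorWeight_nonneg hT k) (by positivity)

lemma sum_normalizedWeight_le (hf : IsCM f) (hint : IntegrableOn f (Ioo 0 1)) {T : ℝ}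
    (hT : 1 ≤ T) (n : ℕ) :
    ∑ k ∈ Finset.range n, normalizedWeight f T k ≤ 2 * ∫ t in Ioo 0 1, f t := by
  have hT0 : 0 < T := by linarith
  have h1 : ∑ k ∈ Finset.range n, normalizedWeight f T k ≤
      2 * ∑ k ∈ Finset.range n, taylorWeight f T k * ∫ t in (0 : ℝ)..1, (1 - t / T) ^ k := by
    rw [Finset.mul_sum]
    refine Finset.sum_le_sum fun k _ => ?_
    have := mul_le_mul_of_nonneg_left (half_div_le_integral_one_sub_div_pow hT k)
      (hf.taylorWeight_nonneg hT0 k)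
    unfold normalizedWeight
    linarith
  have h2 : ∑ k ∈ Finset.range n, taylorWeight f T k * ∫ t in (0 : ℝ)..1, (1 - t / T) ^ k =
      ∫ t in Ioo 0 1, ∑ k ∈ Finset.range n, taylorWeight f T k * (1 - t / T) ^ k := by
    rw [← integral_Ioc_eq_integral_Ioo, ← intervalIntegral.integral_of_le zero_le_one,
      intervalIntegral.integral_finsetSum fun k _ =>
        Continuous.intervalIntegrable (by fun_prop) _ _]
    simp only [intervalIntegral.integral_const_mul]
  have h3 : ∫ t in Ioo 0 1, ∑ k ∈ Finset.range n, taylorWeight f T k * (1 - t / T) ^ k ≤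
      ∫ t in Ioo 0 1, f t := by
    refine setIntegral_mono_on ?_ hint measurableSet_Ioo fun t ht =>
      hf.sum_taylorWeight_le ht.1 (ht.2.trans_le hT) n
    exact (Continuous.integrableOn_Icc (by fun_prop)).mono_set Ioo_subset_Icc_self
  rw [h2] at h1
  linarith

lemma summable_normalizedWeight (hf : IsCM f) (hint : IntegrableOn f (Ioo 0 1)) {T : ℝ}
    (hT : 1 ≤ T) : Summable (normalizedWeight f T) :=
  summable_of_sum_range_le (hf.normalizedWeight_nonneg (by linarith))
    (hf.sum_normalizedWeight_le hint hT)

lemma tsum_normalizedWeight_le (hf : IsCM f) (hint : IntegrableOn f (Ioo 0 1)) {T : ℝ}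
    (hT : 1 ≤ T) : ∑' k, normalizedWeight f T k ≤ 2 * ∫ t in Ioo 0 1, f t :=
  Real.tsum_le_of_sum_range_le (hf.normalizedWeight_nonneg (by linarith))
    (hf.sum_normalizedWeight_le hint hT)

lemma abs_sub_tsum_normalizedWeight_le (hf : IsCM f) (hint : IntegrableOn f (Ioo 0 1)) {T t : ℝ}
    (hT : 1 ≤ T) (ht : 0 < t) (htT : t < T)
    (hs : Summable fun k : ℕ =>
      normalizedWeight f T k * ((1 + k / T) * Real.exp (-t * (k / T)))) :
    |f t - ∑' k : ℕ, normalizedWeight f T k * ((1 + k / T) * Real.exp (-t * (k / T)))| ≤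
      (2 * ∫ t in Ioo 0 1, f t) * ((t + 2) / T) := by
  have hT0 : 0 < T := by linarith
  have hsub := ((hf.hasSum_taylorWeight ht htT).sub hs.hasSum)
  have hb : ∀ k : ℕ, ‖taylorWeight f T k * (1 - t / T) ^ k -
      normalizedWeight f T k * ((1 + k / T) * Real.exp (-t * (k / T)))‖ ≤
      normalizedWeight f T k * ((t + 2) / T) := by
    intro k
    have h1 : taylorWeight f T k = normalizedWeight f T k * (1 + k / T) := by
      have : (1 + k / T : ℝ) ≠ 0 := by positivity
      rw [normalizedWeight]
      field_simp
    rw [h1, mul_assoc, ← mul_sub, ← mul_sub, norm_mul, Real.norm_of_nonneg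
      (hf.normalizedWeight_nonneg hT0 k), Real.norm_eq_abs, abs_mul,
      abs_of_nonneg (by positivity : (0 : ℝ) ≤ 1 + k / T)]
    exact mul_le_mul_of_nonneg_left (abs_one_sub_pow_sub_exp_le ht htT k)
      (hf.normalizedWeight_nonneg hT0 k)
  rw [← hsub.tsum_eq, ← Real.norm_eq_abs]
  refine (tsum_of_norm_bounded
    ((hf.summable_normalizedWeight hint hT).hasSum.mul_right _) hb).trans ?_
  gcongr
  exact hf.tsum_normalizedWeight_le hint hT

/-- The discrete measure on the unit interval carrying the normalised Taylor weights. -/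
noncomputable def taylorMeasure (f : ℝ → ℝ) (T : ℝ) : Measure unitInterval :=
  Measure.sum fun k : ℕ =>
    ENNReal.ofReal (normalizedWeight f T k) • Measure.dirac (expNegPoint (k / T))

lemma taylorMeasure_univ_le (hf : IsCM f) (hint : IntegrableOn f (Ioo 0 1)) {T : ℝ}
    (hT : 1 ≤ T) : taylorMeasure f T univ ≤ ENNReal.ofReal (2 * ∫ t in Ioo 0 1, f t) := by
  rw [taylorMeasure, Measure.sum_apply _ MeasurableSet.univ]
  simp only [Measure.smul_apply, measure_univ, smul_eq_mul, mul_one]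
  rw [← ENNReal.ofReal_tsum_of_nonneg (hf.normalizedWeight_nonneg (by linarith))
    (hf.summable_normalizedWeight hint hT)]
  exact ENNReal.ofReal_le_ofReal (hf.tsum_normalizedWeight_le hint hT)

lemma hasSum_integral_taylorMeasure (hf : IsCM f) (hint : IntegrableOn f (Ioo 0 1)) {T t : ℝ}
    (hT : 1 ≤ T) (ht : 0 < t) :
    HasSum (fun k : ℕ => normalizedWeight f T k * ((1 + k / T) * Real.exp (-t * (k / T))))
      (∫ x, expKernel t ht x ∂taylorMeasure f T) := by
  have hT0 : 0 < T := by linarith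
  have : IsFiniteMeasure (taylorMeasure f T) :=
    ⟨(hf.taylorMeasure_univ_le hint hT).trans_lt ENNReal.ofReal_lt_top⟩
  have h := hasSum_integral_measure ((expKernel t ht).integrable (taylorMeasure f T))
  refine h.congr_fun ?_
  intro k
  rw [integral_smul_measure, integral_dirac, expKernel_expNegPoint ht (by positivity),
    ENNReal.toReal_ofReal (hf.normalizedWeight_nonneg hT0 k), smul_eq_mul]

lemma exists_finiteMeasure_expKernel (hf : IsCM f) (hint : IntegrableOn f (Ioo 0 1)) :
    ∃ ν : FiniteMeasure unitInterval, ∀ t (ht : 0 < t),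
      f t = ∫ x, expKernel t ht x ∂(ν : Measure unitInterval) := by
  have hT : ∀ n : ℕ, (1 : ℝ) ≤ n + 1 := fun n => by linarith [n.cast_nonneg (α := ℝ)]
  let ν : ℕ → FiniteMeasure unitInterval := fun n => ⟨taylorMeasure f (n + 1),
    ⟨(hf.taylorMeasure_univ_le hint (hT n)).trans_lt ENNReal.ofReal_lt_top⟩⟩
  have hmass : ∀ n, ν n ∈ {μ : FiniteMeasure unitInterval |
      μ.mass ≤ (2 * ∫ t in Ioo 0 1, f t).toNNReal} := fun n =>
    ENNReal.toNNReal_mono ENNReal.ofReal_ne_top (hf.taylorMeasure_univ_le hint (hT n))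
  have hU : ((Ultrafilter.of (atTop : Filter ℕ)).map ν : Filter (FiniteMeasure unitInterval)) ≤
      𝓟 {μ | μ.mass ≤ (2 * ∫ t in Ioo 0 1, f t).toNNReal} := by
    rw [le_principal_iff]
    exact mem_map.2 (univ_mem' hmass)
  obtain ⟨ν', -, hν'⟩ := (isCompact_setOfPred_finiteMeasure_le_of_compactSpace unitInterval
    (2 * ∫ t in Ioo 0 1, f t).toNNReal).ultrafilter_le_nhds _ hU
  refine ⟨ν', fun t ht => ?_⟩
  have h1 : Tendsto (fun n => ∫ x, expKernel t ht x ∂(ν n : Measure unitInterval))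
      (Ultrafilter.of (atTop : Filter ℕ)) (nhds (∫ x, expKernel t ht x ∂(ν' : Measure _))) :=
    FiniteMeasure.tendsto_iff_forall_integral_tendsto.1 (tendsto_def.2 fun s hs => hν' hs) _
  have h2 : Tendsto (fun n => ∫ x, expKernel t ht x ∂(ν n : Measure unitInterval))
      atTop (nhds (f t)) := by
    have hlim : Tendsto (fun n : ℕ => (2 * ∫ t in Ioo 0 1, f t) * ((t + 2) / ((n : ℝ) + 1)))
        atTop (nhds 0) := by
      have hden : Tendsto (fun n : ℕ => (n : ℝ) + 1) atTop atTop :=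
        tendsto_atTop_add_const_right _ _ tendsto_natCast_atTop_atTop
      simpa using (hden.const_div_atTop (t + 2)).const_mul (2 * ∫ t in Ioo 0 1, f t)
    rw [tendsto_iff_dist_tendsto_zero]
    refine squeeze_zero' (Eventually.of_forall fun _ => dist_nonneg) ?_ hlim
    filter_upwards [eventually_gt_atTop ⌈t⌉₊] with n hn
    have htn : t < (n : ℝ) + 1 := by
      have : t ≤ ⌈t⌉₊ := Nat.le_ceil t
      have : (⌈t⌉₊ : ℝ) < n := by exact_mod_cast hn
      linarith
    have hs := hf.hasSum_integral_taylorMeasure hint (hT n) ht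
    have := hf.abs_sub_tsum_normalizedWeight_le hint (hT n) ht htn hs.summable
    rw [hs.tsum_eq] at this
    rw [dist_comm, Real.dist_eq]
    exact this
  exact tendsto_nhds_unique (h2.mono_left (Ultrafilter.of_le _)) h1

end IsCM

/-- The representing measure on `[0, ∞)` obtained from a finite measure on the unit interval by
the change of variables `r = -log x` and multiplication by `1 + r`. -/
noncomputable def bernsteinMeasure (ν : Measure unitInterval) : Measure ℝ :=
  ((ν.restrict {x | 0 < (x : ℝ)}).map fun x : unitInterval => -Real.log (x : ℝ)).withDensity
    fun r => ENNReal.ofReal (1 + r)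

lemma measurableSet_unitInterval_pos : MeasurableSet {x : unitInterval | 0 < (x : ℝ)} :=
  measurableSet_lt measurable_const measurable_subtype_coe

lemma measurable_neg_log_unitInterval :
    Measurable fun x : unitInterval => -Real.log (x : ℝ) :=
  (Real.measurable_log.comp measurable_subtype_coe).neg

lemma neg_log_unitInterval_nonneg (x : unitInterval) : 0 ≤ -Real.log (x : ℝ) :=
  neg_nonneg.2 (Real.log_nonpos x.2.1 x.2.2)

lemma bernsteinMeasure_Iio_zero (ν : Measure unitInterval) :
    bernsteinMeasure ν (Iio 0) = 0 := by
  refine withDensity_absolutelyContinuous _ _ ?_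
  rw [Measure.map_apply measurable_neg_log_unitInterval measurableSet_Iio]
  convert! measure_empty (μ := ν.restrict {x | 0 < (x : ℝ)})
  ext x
  simpa using neg_log_unitInterval_nonneg x

lemma bernsteinMeasure_restrict_Ici_zero (ν : Measure unitInterval) :
    (bernsteinMeasure ν).restrict (Ici 0) = bernsteinMeasure ν := by
  refine Measure.restrict_eq_self_of_ae_mem ?_
  have h := bernsteinMeasure_Iio_zero ν
  rw [← compl_Ici] at h
  exact mem_ae_iff.2 h

lemma lintegral_bernsteinMeasure_lt_top (ν : Measure unitInterval) [IsFiniteMeasure ν] :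
    ∫⁻ r in Ici (0 : ℝ), ENNReal.ofReal (1 / (1 + r)) ∂bernsteinMeasure ν < ⊤ := by
  rw [bernsteinMeasure_restrict_Ici_zero, bernsteinMeasure,
    lintegral_withDensity_eq_lintegral_mul _ (by fun_prop) (by fun_prop),
    lintegral_map (by fun_prop) measurable_neg_log_unitInterval]
  calc _ ≤ ∫⁻ _, 1 ∂ν.restrict {x : unitInterval | 0 < (x : ℝ)} := by
        refine lintegral_mono fun x => ?_
        have hx := neg_log_unitInterval_nonneg x
        have h1 : (1 + -Real.log (x : ℝ)) ≠ 0 := by positivity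
        rw [Pi.mul_apply, ← ENNReal.ofReal_mul (by positivity), mul_one_div_cancel h1,
          ENNReal.ofReal_one]
    _ < ⊤ := by simp

lemma integral_bernsteinMeasure (ν : Measure unitInterval) {t : ℝ} (ht : 0 < t) :
    ∫ r in Ici (0 : ℝ), Real.exp (-t * r) ∂bernsteinMeasure ν = ∫ x, expKernel t ht x ∂ν := by
  rw [bernsteinMeasure_restrict_Ici_zero, bernsteinMeasure,
    integral_withDensity_eq_integral_toReal_smul (by fun_prop)
      (Eventually.of_forall fun _ => ENNReal.ofReal_lt_top),
    integral_map measurable_neg_log_unitInterval.aemeasurable (by fun_prop)]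
  have h0 : ∫ x, expKernel t ht x ∂ν =
      ∫ x in {x : unitInterval | 0 < (x : ℝ)}, expKernel t ht x ∂ν := by
    refine (setIntegral_eq_integral_of_forall_compl_eq_zero fun x hx => ?_).symm
    exact expKernel_of_eq_zero ht (le_antisymm (not_lt.1 hx) x.2.1)
  rw [h0]
  refine setIntegral_congr_fun measurableSet_unitInterval_pos fun x hx => ?_
  rw [expKernel_of_pos ht hx, smul_eq_mul, ENNReal.toReal_ofReal]
  linarith [neg_log_unitInterval_nonneg x]

section Laplace

variable {ρ : Measure ℝ}

lemma integrable_exp_neg_mul (hρ : ∀ᵐ r ∂ρ, 0 ≤ r)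
    (hfin : ∫⁻ r, ENNReal.ofReal (1 / (1 + r)) ∂ρ < ⊤) {t : ℝ} (ht : 0 < t) :
    Integrable (fun r => Real.exp (-t * r)) ρ := by
  have hint : Integrable (fun r : ℝ => 1 / (1 + r)) ρ := by
    have hmeas : Measurable fun r : ℝ => 1 / (1 + r) := by fun_prop
    refine ⟨hmeas.aestronglyMeasurable, ?_⟩
    rw [hasFiniteIntegral_iff_ofReal]
    · exact hfin
    · filter_upwards [hρ] with r hr
      simp only [Pi.zero_apply]
      positivity
  refine (hint.const_mul (1 + 1 / t)).mono' (by fun_prop) ?_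
  filter_upwards [hρ] with r hr
  rw [Real.norm_of_nonneg (Real.exp_pos _).le, mul_one_div, le_div_iff₀ (by positivity),
    neg_mul, Real.exp_neg, inv_mul_le_iff₀ (Real.exp_pos _)]
  have h1 := Real.add_one_le_exp (t * r)
  have h2 : 0 ≤ t * r := by positivity
  have h3 : (t * r + 1) * (1 + 1 / t) = 1 + r + t * r + 1 / t := by field_simp; ring
  have h4 : 0 < 1 / t := by positivity
  nlinarith

lemma Ioi_zero_subset_interior_integrableExpSet (hρ : ∀ᵐ r ∂ρ, 0 ≤ r)
    (hfin : ∫⁻ r, ENNReal.ofReal (1 / (1 + r)) ∂ρ < ⊤) :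
    Ioi 0 ⊆ interior (ProbabilityTheory.integrableExpSet (fun r : ℝ => -r) ρ) := by
  refine interior_maximal (fun t ht => ?_) isOpen_Ioi
  simpa [ProbabilityTheory.integrableExpSet] using integrable_exp_neg_mul hρ hfin ht

lemma isCM_of_eq_integral_exp {f : ℝ → ℝ} (hρ : ∀ᵐ r ∂ρ, 0 ≤ r)
    (hfin : ∫⁻ r, ENNReal.ofReal (1 / (1 + r)) ∂ρ < ⊤)
    (hf : ∀ t, 0 < t → f t = ∫ r, Real.exp (-t * r) ∂ρ) : IsCM f := by
  have hsub := Ioi_zero_subset_interior_integrableExpSet hρ hfin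
  have heq : EqOn f (ProbabilityTheory.mgf (fun r : ℝ => -r) ρ) (Ioi 0) := fun t ht => by
    simp [hf t ht, ProbabilityTheory.mgf]
  refine ⟨?_, fun n t ht => ?_⟩
  · have han : AnalyticOnNhd ℝ (ProbabilityTheory.mgf (fun r : ℝ => -r) ρ) (Ioi 0) :=
      ProbabilityTheory.analyticOnNhd_mgf.mono hsub
    exact (han.contDiffOn (uniqueDiffOn_Ioi 0)).congr heq
  · rw [iteratedDerivWithin_congr heq ht, iteratedDerivWithin_of_isOpen isOpen_Ioi ht,
      ProbabilityTheory.iteratedDeriv_mgf (hsub ht), ← integral_const_mul]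
    refine integral_nonneg_of_ae ?_
    filter_upwards [hρ] with r hr
    rw [← mul_assoc, ← mul_pow, neg_one_mul, neg_neg]
    positivity

lemma lintegral_exp_neg_mul_Ioo_le {r : ℝ} (hr : 0 ≤ r) :
    ∫⁻ t in Ioo (0 : ℝ) 1, ENNReal.ofReal ((1 + r) * Real.exp (-t * r)) ≤ 2 := by
  have hint : IntegrableOn (fun t : ℝ => (1 + r) * Real.exp (-t * r)) (Ioo 0 1) :=
    (Continuous.integrableOn_Icc (by fun_prop)).mono_set Ioo_subset_Icc_self
  rw [← ofReal_integral_eq_lintegral_ofReal hint (Eventually.of_forall fun t => by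
    simp only [Pi.zero_apply]; positivity)]
  refine ENNReal.ofReal_le_of_le_toReal ?_
  have hd : ∀ t ∈ uIcc (0 : ℝ) 1, HasDerivAt (fun t : ℝ => -Real.exp (-t * r))
      (r * Real.exp (-t * r)) t := by
    intro t _
    have := (((hasDerivAt_id t).neg.mul_const r).exp).neg
    convert! this using 1
    simp
    ring
  have h1 : ∫ t in (0 : ℝ)..1, r * Real.exp (-t * r) = 1 - Real.exp (-r) := by
    rw [intervalIntegral.integral_eq_sub_of_hasDerivAt hd
      (Continuous.intervalIntegrable (by fun_prop) _ _)]
    simp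
    ring
  have h2 : ∫ t in (0 : ℝ)..1, Real.exp (-t * r) ≤ ∫ _t in (0 : ℝ)..1, (1 : ℝ) := by
    refine intervalIntegral.integral_mono_on zero_le_one
      (Continuous.intervalIntegrable (by fun_prop) _ _) (by simp) fun t ht => ?_
    rw [Real.exp_le_one_iff]
    nlinarith [ht.1]
  have h3 : ∫ t in Ioo (0 : ℝ) 1, (1 + r) * Real.exp (-t * r) =
      (∫ t in (0 : ℝ)..1, Real.exp (-t * r)) + ∫ t in (0 : ℝ)..1, r * Real.exp (-t * r) := by
    rw [← intervalIntegral.integral_add (Continuous.intervalIntegrable (by fun_prop) _ _)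
      (Continuous.intervalIntegrable (by fun_prop) _ _),
      intervalIntegral.integral_of_le zero_le_one, integral_Ioc_eq_integral_Ioo]
    congr 1 with t
    ring
  rw [h3, h1]
  simp at h2 ⊢
  linarith [Real.exp_pos (-r)]

lemma integrableOn_Ioo_of_eq_integral_exp {f : ℝ → ℝ} (hρ : ∀ᵐ r ∂ρ, 0 ≤ r)
    (hfin : ∫⁻ r, ENNReal.ofReal (1 / (1 + r)) ∂ρ < ⊤)
    (hf : ∀ t, 0 < t → f t = ∫ r, Real.exp (-t * r) ∂ρ) : IntegrableOn f (Ioo 0 1) := by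
  have hcont : ContinuousOn f (Ioo 0 1) :=
    (isCM_of_eq_integral_exp hρ hfin hf).1.continuousOn.mono Ioo_subset_Ioi_self
  refine ⟨hcont.aestronglyMeasurable measurableSet_Ioo, ?_⟩
  rw [hasFiniteIntegral_iff_ofReal]
  swap
  · filter_upwards [ae_restrict_mem measurableSet_Ioo] with t ht
    rw [hf t ht.1]
    exact integral_nonneg fun r => (Real.exp_pos _).le
  set σ : Measure ℝ := ρ.withDensity fun r => ENNReal.ofReal (1 / (1 + r)) with hσ
  have hσfin : IsFiniteMeasure σ := ⟨by rwa [hσ, withDensity_apply _ .univ, setLIntegral_univ]⟩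
  have hσ0 : ∀ᵐ r ∂σ, 0 ≤ r := withDensity_absolutelyContinuous _ _ hρ
  have h1 : ∀ t ∈ Ioo (0 : ℝ) 1, ENNReal.ofReal (f t) =
      ∫⁻ r, ENNReal.ofReal ((1 + r) * Real.exp (-t * r)) ∂σ := by
    intro t ht
    rw [hf t ht.1, ofReal_integral_eq_lintegral_ofReal (integrable_exp_neg_mul hρ hfin ht.1)
      (Eventually.of_forall fun r => (Real.exp_pos _).le), hσ,
      lintegral_withDensity_eq_lintegral_mul _ (by fun_prop) (by fun_prop)]
    refine lintegral_congr_ae ?_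
    filter_upwards [hρ] with r hr
    rw [Pi.mul_apply, ← ENNReal.ofReal_mul (by positivity)]
    have : (1 + r) ≠ 0 := by positivity
    congr 1
    field_simp
  rw [setLIntegral_congr_fun measurableSet_Ioo h1,
    lintegral_lintegral_swap (by fun_prop)]
  calc _ ≤ ∫⁻ _, 2 ∂σ := by
        refine lintegral_mono_ae ?_
        filter_upwards [hσ0] with r hr using lintegral_exp_neg_mul_Ioo_le hr
    _ < ⊤ := by
        rw [lintegral_const]
        exact ENNReal.mul_lt_top (by simp) (measure_lt_top σ _)

end Laplace

/-- characterization of LICM functions: `f : (0,∞) → ℝ` is completely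
monotone and integrable on `(0,1)` if and only if there is a positive measure `μ` on
`[0,∞)` with `∫ 1/(1+r) dμ(r) < ∞` and `f(t) = ∫_{[0,∞)} e^{-tr} dμ(r)` for all `t > 0`. -/
theorem licm_characterization (f : ℝ → ℝ) :
    (IsCM f ∧ IntegrableOn f (Set.Ioo 0 1)) ↔
    ∃ μ : Measure ℝ, μ (Set.Iio 0) = 0 ∧
      (∫⁻ r in Set.Ici (0 : ℝ), ENNReal.ofReal (1 / (1 + r)) ∂μ < ⊤) ∧
      ∀ t : ℝ, 0 < t → f t = ∫ r in Set.Ici (0 : ℝ), Real.exp (-t * r) ∂μ := by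
  constructor
  · rintro ⟨hf, hint⟩
    obtain ⟨ν, hν⟩ := hf.exists_finiteMeasure_expKernel hint
    exact ⟨bernsteinMeasure ν, bernsteinMeasure_Iio_zero _, lintegral_bernsteinMeasure_lt_top _,
      fun t ht => (hν t ht).trans (integral_bernsteinMeasure _ ht).symm⟩
  · rintro ⟨μ, -, hfin, hf⟩
    have hρ : ∀ᵐ r ∂μ.restrict (Ici 0), 0 ≤ r := ae_restrict_mem measurableSet_Ici
    exact ⟨isCM_of_eq_integral_exp hρ hfin hf, integrableOn_Ioo_of_eq_integral_exp hρ hfin hf⟩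
end
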